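/- arXiv:1205.5926 — 3 statements merged into one kernel-verified Lean document; each statement's English description precedes it below -/
import Mathlib

section
/- A map F from a domain O in a complex Banach space X to a complex Banach space Y is complex-analytic if and only if it is locally bounded and weakly analytic, i.e., for each x in O, each u in X, and each continuous linear functional ξ on Y, there exists ε > 0 such that the function z ↦ ξ(F(x + z·u)) is analytic on the disc {z ∈ ℂ : |z| < ε}. -/
open Metric Set Filter Topology

/-- A bounded function on a disc is differentiable at the centre as soon as its composition with
each member of a norming family of contractions is differentiable on the disc. -/
theorem differentiableAt_of_norming {E G : Type*}
    [NormedAddCommGroup E] [NormedSpace ℂ E] [CompleteSpace E]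
    [NormedAddCommGroup G] [NormedSpace ℂ G] [CompleteSpace G]
    {S : Set (E →L[ℂ] G)} (hS : ∀ T ∈ S, ‖T‖ ≤ 1)
    (hnorm : ∀ (e : E) (M : ℝ), 0 ≤ M → (∀ T ∈ S, ‖T e‖ ≤ M) → ‖e‖ ≤ M)
    {f : ℂ → E} {c : ℂ} {R C : ℝ} (hR : 0 < R) (hb : ∀ z ∈ ball c R, ‖f z‖ ≤ C)
    (hd : ∀ T ∈ S, DifferentiableOn ℂ (fun z => T (f z)) (ball c R)) :
    DifferentiableAt ℂ f c := by
  have hC : 0 ≤ C := (norm_nonneg _).trans (hb c (mem_ball_self hR))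
  have hTb : ∀ T ∈ S, ∀ e : E, ‖T e‖ ≤ ‖e‖ := fun T hT e =>
    (T.le_opNorm e).trans (mul_le_of_le_one_left (norm_nonneg e) (hS T hT))
  have hlip : ∀ w ∈ ball c (R / 2), ∀ z ∈ ball w (R / 2),
      ‖f z - f w‖ ≤ 2 * C / (R / 2) * dist z w := by
    intro w hw z hz
    have hsub : ball w (R / 2) ⊆ ball c R := by
      apply ball_subset_ball'
      rw [mem_ball] at hw
      linarith
    refine hnorm _ _ (by positivity) fun T hT => ?_
    rw [map_sub, ← dist_eq_norm]
    refine Complex.dist_le_div_mul_dist_of_mapsTo_ball ((hd T hT).mono hsub) (fun v hv => ?_) hz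
    rw [mem_closedBall, dist_eq_norm, ← map_sub]
    refine (hTb T hT _).trans ((norm_sub_le _ _).trans ?_)
    have h1 := hb v (hsub hv)
    have h2 := hb w (hsub (mem_ball_self (by positivity)))
    linarith
  have hcont : ∀ w ∈ ball c (R / 2), ContinuousAt f w := by
    intro w hw
    rw [ContinuousAt, tendsto_iff_norm_sub_tendsto_zero]
    have hlim : Tendsto (fun z => 2 * C / (R / 2) * dist z w) (𝓝 w) (𝓝 0) := by
      have : Tendsto (fun z => 2 * C / (R / 2) * dist z w) (𝓝 w)
          (𝓝 (2 * C / (R / 2) * dist w w)) := Continuous.tendsto (by fun_prop) w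
      simpa using this
    refine squeeze_zero' (Eventually.of_forall fun _ => norm_nonneg _) ?_ hlim
    filter_upwards [ball_mem_nhds w (by positivity : 0 < R / 2)] with z hz using hlip w hw z hz
  lift R to NNReal using hR.le
  have hR' : (0 : NNReal) < R / 4 := by
    have : (0 : NNReal) < R := by exact_mod_cast hR
    positivity
  have hR4 : (((R / 4 : NNReal)) : ℝ) = (R : ℝ) / 4 := by simp
  have hsub : closedBall c ((R / 4 : NNReal) : ℝ) ⊆ ball c ((R : ℝ) / 2) := by
    apply closedBall_subset_ball
    rw [hR4]; linarith
  have hfc : ContinuousOn f (closedBall c ((R / 4 : NNReal) : ℝ)) := fun w hw =>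
    (hcont w (hsub hw)).continuousWithinAt
  have hci : ∀ w ∈ ball c ((R / 4 : NNReal) : ℝ),
      CircleIntegrable (fun z => (z - w)⁻¹ • f z) c (R / 4 : NNReal) := by
    intro w hw
    refine ContinuousOn.circleIntegrable (by positivity) ?_
    refine ContinuousOn.smul (ContinuousOn.inv₀ (by fun_prop) fun z hz => ?_)
      (hfc.mono sphere_subset_closedBall)
    rw [sub_ne_zero]
    rintro rfl
    rw [mem_sphere] at hz
    rw [mem_ball] at hw
    exact hw.ne hz
  have hps := hasFPowerSeriesOn_cauchy_integral
    (ContinuousOn.circleIntegrable (by positivity) (hfc.mono sphere_subset_closedBall)) hR'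
  refine hps.analyticAt.differentiableAt.congr_of_eventuallyEq ?_
  filter_upwards [ball_mem_nhds c (by exact_mod_cast hR' : (0 : ℝ) < (R / 4 : NNReal))] with w hw
  rw [← sub_eq_zero, ← norm_le_zero_iff]
  refine hnorm _ _ le_rfl fun T hT => ?_
  rw [map_sub, map_smul, norm_le_zero_iff, sub_eq_zero]
  have hcomm : T (∮ z in C(c, (R / 4 : NNReal)), (z - w)⁻¹ • f z)
      = ∮ z in C(c, (R / 4 : NNReal)), (z - w)⁻¹ • T (f z) := by
    rw [circleIntegral, circleIntegral, ← ContinuousLinearMap.intervalIntegral_comp_comm]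
    · simp only [map_smul]
    · exact (hci w hw).out
  have hsub' : closedBall c ((R / 4 : NNReal) : ℝ) ⊆ ball c R :=
    hsub.trans (ball_subset_ball (by linarith))
  rw [hcomm, ((hd T hT).mono hsub').circleIntegral_sub_inv_smul hw, smul_smul,
    inv_mul_cancel₀ Complex.two_pi_I_ne_zero, one_smul]

/-- Second-order Taylor estimate for a bounded holomorphic function on a disc. -/
theorem norm_sub_sub_smul_deriv_le {E : Type*} [NormedAddCommGroup E] [NormedSpace ℂ E]
    {f : ℂ → E} {R C : ℝ} (hd : DifferentiableOn ℂ f (ball 0 R))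
    (hb : ∀ z ∈ ball (0 : ℂ) R, ‖f z‖ ≤ C) {z : ℂ} (hz : z ∈ ball (0 : ℂ) R) :
    ‖f z - f 0 - z • deriv f 0‖ ≤ 4 * C * (‖z‖ / R) ^ 2 := by
  have hR : 0 < R := nonempty_ball.mp ⟨z, hz⟩
  have hC : ‖f 0‖ ≤ C := hb 0 (mem_ball_self hR)
  have h2 : ∀ w ∈ ball (0 : ℂ) R, ‖f w - f 0‖ ≤ 2 * C := fun w hw =>
    (norm_sub_le _ _).trans (by linarith [hb w hw])
  have hder : ‖deriv f 0‖ ≤ 2 * C / R :=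
    Complex.norm_deriv_le_div_of_mapsTo_ball hd
      (fun w hw => by rw [mem_closedBall, dist_eq_norm]; exact h2 w hw) hR
  have key := Complex.dist_le_mul_div_pow_of_mapsTo_ball_of_isLittleO
    (f := fun w => f w - w • deriv f 0) (c := 0) (R₁ := R) (R₂ := 4 * C) (n := 1) (z := z)
    (hd.sub (by fun_prop)) ?_ ?_ hz
  · simpa [dist_eq_norm, sub_right_comm] using key
  · intro w hw
    have hw' : ‖w‖ < R := by simpa using hw
    have h3 : ‖w • deriv f 0‖ ≤ 2 * C := by
      rw [norm_smul]
      calc ‖w‖ * ‖deriv f 0‖ ≤ R * (2 * C / R) := by gcongr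
        _ = 2 * C := by field_simp
    rw [mem_closedBall, dist_eq_norm]
    simp only [zero_smul, sub_zero]
    rw [sub_right_comm]
    refine (norm_sub_le _ _).trans ?_
    linarith [h2 w hw]
  · have h0 := (hd.differentiableAt (ball_mem_nhds 0 hR)).hasDerivAt
    rw [hasDerivAt_iff_isLittleO] at h0
    simpa [sub_right_comm] using h0.norm_right

theorem ball_sub_mul_subset {X : Type*} [PseudoMetricSpace X] {x : X} {r s : ℝ} (hs : 0 ≤ s)
    (n : ℕ) : ball x (r - n * s) ⊆ ball x r :=
  ball_subset_ball (sub_le_self r (by positivity))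

theorem exists_mem_ball_sub_mul {X : Type*} [PseudoMetricSpace X] {x y : X} {r : ℝ}
    (hy : y ∈ ball x r) (n : ℕ) : ∃ s > 0, y ∈ ball x (r - n * s) := by
  rw [mem_ball] at hy
  have hpos := sub_pos.mpr hy
  refine ⟨(r - dist y x) / (n + 1), by positivity, ?_⟩
  have h1 : (n : ℝ) * ((r - dist y x) / (n + 1)) < r - dist y x := by
    rw [mul_div_assoc', div_lt_iff₀ (by positivity)]
    nlinarith
  rw [mem_ball]
  linarith

section Gateaux

variable {X E : Type*} [NormedAddCommGroup X] [NormedSpace ℂ X]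
  [NormedAddCommGroup E] [NormedSpace ℂ E]

/-- Complex differentiability along all complex lines through the points of `U`. -/
def GateauxHolomorphicOn (F : X → E) (U : Set X) : Prop :=
  ∀ x ∈ U, ∀ u : X, DifferentiableAt ℂ (fun z : ℂ => F (x + z • u)) 0

namespace GateauxHolomorphicOn

variable {F : X → E} {U : Set X}

theorem differentiableAt_line (h : GateauxHolomorphicOn F U) {x u : X} {z : ℂ}
    (hz : x + z • u ∈ U) : DifferentiableAt ℂ (fun w : ℂ => F (x + w • u)) z := by
  have h1 : DifferentiableAt ℂ (fun w : ℂ => F (x + z • u + w • u)) (z - z) := by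
    simpa using h _ hz u
  have h2 := h1.comp z (f := fun w : ℂ => w - z) (by fun_prop)
  have heq : (fun w : ℂ => F (x + w • u))
      = (fun w : ℂ => F (x + z • u + w • u)) ∘ fun w => w - z := by
    funext w
    simp only [Function.comp_apply]
    congr 1
    module
  rwa [heq]

theorem mono {V : Set X} (h : GateauxHolomorphicOn F U) (hV : V ⊆ U) :
    GateauxHolomorphicOn F V := fun x hx => h x (hV hx)

theorem differentiableOn_line (h : GateauxHolomorphicOn F U) {x u : X} {V : Set ℂ}
    (hV : ∀ z ∈ V, x + z • u ∈ U) : DifferentiableOn ℂ (fun w : ℂ => F (x + w • u)) V :=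
  fun z hz => (h.differentiableAt_line (hV z hz)).differentiableWithinAt

theorem add_smul_mem_ball {x u : X} {s : ℝ} {z : ℂ}
    (hz : z ∈ ball (0 : ℂ) (s / (‖u‖ + 1))) : x + z • u ∈ ball x s := by
  have hz' : ‖z‖ < s / (‖u‖ + 1) := by simpa using hz
  rw [lt_div_iff₀ (by positivity)] at hz'
  rw [mem_ball, dist_eq_norm, add_sub_cancel_left, norm_smul]
  nlinarith [norm_nonneg z, norm_nonneg u]

/-- The remainder of the first-order expansion along a line is uniformly quadratic. -/
theorem norm_sub_sub_smul_deriv_le {x u : X} {s C : ℝ}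
    (h : GateauxHolomorphicOn F (ball x s)) (hb : ∀ y ∈ ball x s, ‖F y‖ ≤ C) {z : ℂ}
    (hz : z ∈ ball (0 : ℂ) (s / (‖u‖ + 1))) :
    ‖F (x + z • u) - F x - z • deriv (fun w : ℂ => F (x + w • u)) 0‖
      ≤ 4 * C * (‖z‖ / (s / (‖u‖ + 1))) ^ 2 := by
  simpa using _root_.norm_sub_sub_smul_deriv_le
    (h.differentiableOn_line fun z hz => add_smul_mem_ball (u := u) hz)
    (fun z hz => hb _ (add_smul_mem_ball hz)) hz

/-- The Gateaux derivative is holomorphic along lines, being a uniform limit of difference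
quotients. -/
theorem deriv_line [CompleteSpace E] {x : X} {r C : ℝ} (hr : 0 < r)
    (h : GateauxHolomorphicOn F (ball x r)) (hb : ∀ y ∈ ball x r, ‖F y‖ ≤ C) (u v : X) :
    DifferentiableAt ℂ (fun z : ℂ => deriv (fun w : ℂ => F (x + z • u + w • v)) 0) 0 := by
  have hC : 0 ≤ C := (norm_nonneg _).trans (hb x (mem_ball_self hr))
  have hr2 : 0 < r / 2 := by positivity
  set ρ := r / 2 / (‖u‖ + 1) with hρ
  have hρ0 : 0 < ρ := by positivity
  set σ := r / 2 / (‖v‖ + 1) with hσ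
  have hσ0 : 0 < σ := by positivity
  have hsub : ∀ z ∈ ball (0 : ℂ) ρ, ball (x + z • u) (r / 2) ⊆ ball x r := by
    intro z hz
    apply ball_subset_ball'
    have := add_smul_mem_ball (x := x) hz
    rw [mem_ball] at this
    linarith
  have hlim : TendstoUniformlyOn
      (fun (w z : ℂ) => w⁻¹ • (F (x + z • u + w • v) - F (x + z • u)))
      (fun z : ℂ => deriv (fun w : ℂ => F (x + z • u + w • v)) 0) (𝓝[≠] 0) (ball 0 ρ) := by
    rw [Metric.tendstoUniformlyOn_iff]
    intro ε hε
    have ht : Tendsto (fun w : ℂ => 4 * C / σ ^ 2 * ‖w‖) (𝓝[≠] 0) (𝓝 0) := by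
      have : Tendsto (fun w : ℂ => 4 * C / σ ^ 2 * ‖w‖) (𝓝 0)
        (𝓝 (4 * C / σ ^ 2 * ‖(0 : ℂ)‖)) := Continuous.tendsto (by fun_prop) 0
      simp only [norm_zero, mul_zero] at this
      exact this.mono_left nhdsWithin_le_nhds
    filter_upwards [ht.eventually_lt_const hε, self_mem_nhdsWithin,
      mem_nhdsWithin_of_mem_nhds (ball_mem_nhds (0 : ℂ) hσ0)] with w hw hw0 hwσ z hz
    have hw0 : w ≠ 0 := hw0
    have key := norm_sub_sub_smul_deriv_le (h.mono (hsub z hz))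
      (fun y hy => hb y (hsub z hz hy)) (u := v) hwσ
    refine lt_of_le_of_lt ?_ hw
    rw [dist_comm, dist_eq_norm]
    have heq : w⁻¹ • (F (x + z • u + w • v) - F (x + z • u))
        - deriv (fun w : ℂ => F (x + z • u + w • v)) 0
        = w⁻¹ • (F (x + z • u + w • v) - F (x + z • u)
          - w • deriv (fun w : ℂ => F (x + z • u + w • v)) 0) := by
      rw [smul_sub w⁻¹ (_ - _), smul_smul, inv_mul_cancel₀ hw0, one_smul]
    rw [heq, norm_smul, norm_inv]
    have hwn : 0 < ‖w‖ := norm_pos_iff.mpr hw0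
    rw [← hσ] at key
    calc ‖w‖⁻¹ * _ ≤ ‖w‖⁻¹ * (4 * C * (‖w‖ / σ) ^ 2) := by gcongr
      _ = 4 * C / σ ^ 2 * ‖w‖ := by field_simp
  refine (hlim.tendstoLocallyUniformlyOn.differentiableOn ?_ isOpen_ball).differentiableAt
    (ball_mem_nhds 0 hρ0)
  filter_upwards [mem_nhdsWithin_of_mem_nhds (ball_mem_nhds (0 : ℂ) hσ0)] with w hwσ
  refine DifferentiableOn.const_smul (DifferentiableOn.sub ?_ ?_) _
  · have : DifferentiableOn ℂ (fun z : ℂ => F (x + w • v + z • u)) (ball 0 ρ) := by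
      refine h.differentiableOn_line fun z hz => ?_
      rw [add_right_comm]
      exact hsub z hz (add_smul_mem_ball hwσ)
    simpa only [add_right_comm] using this
  · exact h.differentiableOn_line fun z hz => hsub z hz (mem_ball_self hr2)

theorem hasDerivAt_line (h : GateauxHolomorphicOn F U) {x : X} (hx : x ∈ U) (u : X) :
    HasDerivAt (fun w : ℂ => F (x + w • u)) (deriv (fun w : ℂ => F (x + w • u)) 0) 0 :=
  (h x hx u).hasDerivAt

theorem deriv_smul (h : GateauxHolomorphicOn F U) {x : X} (hx : x ∈ U) (a : ℂ) (u : X) :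
    deriv (fun w : ℂ => F (x + w • a • u)) 0 = a • deriv (fun w : ℂ => F (x + w • u)) 0 := by
  have h1 : HasDerivAt (fun w : ℂ => F (x + w • u)) (deriv (fun w : ℂ => F (x + w • u)) 0)
      (0 * a) := by simpa using h.hasDerivAt_line hx u
  have h2 := h1.scomp (0 : ℂ) (hasDerivAt_mul_const a)
  rw [← h2.deriv]
  simp only [Function.comp_def, smul_smul]

theorem deriv_add [CompleteSpace E] {x : X} {r C : ℝ} (hr : 0 < r)
    (h : GateauxHolomorphicOn F (ball x r)) (hb : ∀ y ∈ ball x r, ‖F y‖ ≤ C) (u v : X) :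
    deriv (fun w : ℂ => F (x + w • (u + v))) 0
      = deriv (fun w : ℂ => F (x + w • u)) 0 + deriv (fun w : ℂ => F (x + w • v)) 0 := by
  have hr2 : 0 < r / 2 := by positivity
  set ρ := r / 2 / (‖u‖ + 1) with hρ
  have hρ0 : 0 < ρ := by positivity
  set σ := r / 2 / (‖v‖ + 1) with hσ
  have hσ0 : 0 < σ := by positivity
  set D : ℂ → E := fun z => deriv (fun w : ℂ => F (x + z • u + w • v)) 0 with hD
  have hDc : ContinuousAt D 0 := (deriv_line hr h hb u v).continuousAt
  have hD0 : D 0 = deriv (fun w : ℂ => F (x + w • v)) 0 := by simp [hD]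
  have h1 : HasDerivAt (fun z : ℂ => z • D z) (D 0) 0 := by
    rw [hasDerivAt_iff_tendsto_slope]
    refine (hDc.tendsto.mono_left nhdsWithin_le_nhds).congr' ?_
    filter_upwards [self_mem_nhdsWithin] with z hz
    simp [slope_def_module, smul_smul, inv_mul_cancel₀ (show z ≠ 0 from hz)]
  have h2 : HasDerivAt (fun z : ℂ => F (x + z • (u + v)) - F (x + z • u) - z • D z) 0 0 := by
    rw [hasDerivAt_iff_isLittleO]
    simp only [zero_smul, add_zero, sub_self, sub_zero, smul_zero]
    refine (Asymptotics.IsBigO.of_bound (4 * C / σ ^ 2) ?_).trans_isLittleO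
      (Asymptotics.isLittleO_pow_id one_lt_two)
    filter_upwards [ball_mem_nhds (0 : ℂ) hσ0, ball_mem_nhds (0 : ℂ) hρ0] with z hzσ hzρ
    have hsub : ball (x + z • u) (r / 2) ⊆ ball x r := by
      apply ball_subset_ball'
      have := add_smul_mem_ball (x := x) hzρ
      rw [mem_ball] at this
      linarith
    have key := norm_sub_sub_smul_deriv_le (h.mono hsub)
      (fun y hy => hb y (hsub hy)) (u := v) hzσ
    rw [smul_add, ← add_assoc]
    refine key.trans_eq ?_
    rw [← hσ, norm_pow]
    ring
  have h3 := (h2.add h1).add (h.hasDerivAt_line (mem_ball_self hr) u)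
  have h4 : HasDerivAt (fun w : ℂ => F (x + w • (u + v)))
      (0 + D 0 + deriv (fun w : ℂ => F (x + w • u)) 0) 0 := by
    convert h3 using 2 with w
    simp
  rw [h4.deriv, hD0, zero_add, add_comm]

/-- A bounded Gateaux-holomorphic map on a ball is Fréchet differentiable at the centre. -/
theorem differentiableAt_center [CompleteSpace E] {x : X} {r C : ℝ} (hr : 0 < r)
    (h : GateauxHolomorphicOn F (ball x r)) (hb : ∀ y ∈ ball x r, ‖F y‖ ≤ C) :
    DifferentiableAt ℂ F x := by
  have hC : 0 ≤ C := (norm_nonneg _).trans (hb x (mem_ball_self hr))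
  let L : X →ₗ[ℂ] E :=
    { toFun := fun u => deriv (fun w : ℂ => F (x + w • u)) 0
      map_add' := deriv_add hr h hb
      map_smul' := fun a u => h.deriv_smul (mem_ball_self hr) a u }
  have hline : ∀ u : X, ‖u‖ ≤ 1 → ∀ z ∈ ball (0 : ℂ) r, x + z • u ∈ ball x r := by
    intro u hu z hz
    have hz' : ‖z‖ < r := by simpa using hz
    rw [mem_ball, dist_eq_norm, add_sub_cancel_left, norm_smul]
    nlinarith [norm_nonneg z]
  have hbound : ∀ u : X, ‖L u‖ ≤ 2 * C / r * ‖u‖ := by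
    intro u
    rcases eq_or_ne u 0 with rfl | hu
    · simp
    have hu' : 0 < ‖u‖ := norm_pos_iff.mpr hu
    set e : X := ((‖u‖ : ℂ)⁻¹) • u with he
    have he1 : ‖e‖ = 1 := by simp [he, norm_smul, hu'.ne']
    have hue : u = (‖u‖ : ℂ) • e := by
      rw [he, smul_smul, mul_inv_cancel₀ (by exact_mod_cast hu'.ne'), one_smul]
    have hLe : ‖L e‖ ≤ 2 * C / r := by
      refine Complex.norm_deriv_le_div_of_mapsTo_ball
        (h.differentiableOn_line (hline e he1.le)) (fun w hw => ?_) hr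
      rw [mem_closedBall, dist_eq_norm]
      refine (norm_sub_le _ _).trans ?_
      have h1 := hb _ (hline e he1.le w hw)
      have h2 := hb _ (hline e he1.le 0 (mem_ball_self hr))
      linarith
    calc ‖L u‖ = ‖u‖ * ‖L e‖ := by
          conv_lhs => rw [hue]
          rw [map_smul, norm_smul]
          simp
      _ ≤ ‖u‖ * (2 * C / r) := by gcongr
      _ = _ := mul_comm _ _
  have hfd : HasFDerivAt F (L.mkContinuous _ hbound) x := by
    rw [hasFDerivAt_iff_isLittleO_nhds_zero]
    have hpow : (fun y : X => ‖y‖ ^ 2) =o[𝓝 0] fun y : X => y :=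
      Asymptotics.isLittleO_norm_pow_id one_lt_two
    refine (Asymptotics.IsBigO.of_bound (4 * C / (r / 2) ^ 2) ?_).trans_isLittleO hpow
    filter_upwards [ball_mem_nhds (0 : X) (by positivity : 0 < r / 2)] with y hy
    rcases eq_or_ne y 0 with rfl | hy0
    · simp
    have hy' : 0 < ‖y‖ := norm_pos_iff.mpr hy0
    have hyr : ‖y‖ < r / 2 := by simpa using hy
    set e : X := ((‖y‖ : ℂ)⁻¹) • y with he
    have he1 : ‖e‖ = 1 := by simp [he, norm_smul, hy'.ne']
    have hye : y = (‖y‖ : ℂ) • e := by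
      rw [he, smul_smul, mul_inv_cancel₀ (by exact_mod_cast hy'.ne'), one_smul]
    have hmem : (‖y‖ : ℂ) ∈ ball (0 : ℂ) (r / (‖e‖ + 1)) := by
      rw [he1]; simp; linarith
    have key := norm_sub_sub_smul_deriv_le h hb hmem
    have hL : L y = (‖y‖ : ℂ) • deriv (fun w : ℂ => F (x + w • e)) 0 := by
      conv_lhs => rw [hye]
      rw [map_smul]; rfl
    rw [← hL, ← hye, he1] at key
    rw [LinearMap.mkContinuous_apply]
    refine key.trans_eq ?_
    simp
    ring
  exact hfd.differentiableAt

theorem differentiableAt_of_mem_ball [CompleteSpace E] {x : X} {r C : ℝ}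
    (h : GateauxHolomorphicOn F (ball x r)) (hb : ∀ y ∈ ball x r, ‖F y‖ ≤ C) :
    ∀ y ∈ ball x r, DifferentiableAt ℂ F y := by
  intro y hy
  obtain ⟨s, hs, hsub⟩ := Metric.isOpen_iff.mp isOpen_ball y hy
  exact differentiableAt_center hs (h.mono hsub) fun z hz => hb z (hsub hz)

theorem norm_fderiv_le [CompleteSpace E] {x : X} {r C s : ℝ} (hs : 0 < s)
    (h : GateauxHolomorphicOn F (ball x r)) (hb : ∀ y ∈ ball x r, ‖F y‖ ≤ C) :
    ∀ y ∈ ball x (r - s), ‖fderiv ℂ F y‖ ≤ C * (2 / s) := by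
  intro y hy
  have hsub : ball y s ⊆ ball x r := by
    apply ball_subset_ball'
    rw [mem_ball] at hy
    linarith
  have key := Complex.norm_fderiv_le_div_of_mapsTo_ball (f := F) (c := y) (R₁ := s) (R₂ := 2 * C)
    (fun z hz => (h.differentiableAt_of_mem_ball hb z (hsub hz)).differentiableWithinAt) (fun z hz => ?_) hs
  · exact key.trans_eq (by ring)
  · rw [mem_closedBall, dist_eq_norm]
    refine (norm_sub_le _ _).trans ?_
    linarith [hb z (hsub hz), hb y (hsub (mem_ball_self hs))]

theorem fderiv_apply [CompleteSpace E] {x : X} {r C : ℝ}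
    (h : GateauxHolomorphicOn F (ball x r)) (hb : ∀ y ∈ ball x r, ‖F y‖ ≤ C) (v : X) :
    GateauxHolomorphicOn (fun y => fderiv ℂ F y v) (ball x r) := by
  intro y hy u
  obtain ⟨s, hs, hsub⟩ := Metric.isOpen_iff.mp isOpen_ball y hy
  refine (deriv_line hs (h.mono hsub) (fun z hz => hb z (hsub hz)) u v).congr_of_eventuallyEq ?_
  filter_upwards [ball_mem_nhds (0 : ℂ) (by positivity : 0 < s / (‖u‖ + 1))] with z hz
  have hd := (h.differentiableAt_of_mem_ball hb _ (hsub (add_smul_mem_ball hz))).hasFDerivAt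
  have hl : HasDerivAt (fun w : ℂ => y + z • u + w • v) v 0 := by
    simpa using ((hasDerivAt_id (0 : ℂ)).smul_const v).const_add (y + z • u)
  exact (hd.comp_hasDerivAt_of_eq (0 : ℂ) hl (by simp)).deriv.symm

protected theorem fderiv [CompleteSpace E] {x : X} {r C : ℝ}
    (h : GateauxHolomorphicOn F (ball x r)) (hb : ∀ y ∈ ball x r, ‖F y‖ ≤ C) :
    GateauxHolomorphicOn (fderiv ℂ F) (ball x r) := by
  intro y hy u
  obtain ⟨s, hs, hsub⟩ := Metric.isOpen_iff.mp isOpen_ball y hy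
  replace h := h.mono hsub
  replace hb : ∀ z ∈ ball y s, ‖F z‖ ≤ C := fun z hz => hb z (hsub hz)
  have hs2 : 0 < s / 2 := by positivity
  set S : Set ((X →L[ℂ] E) →L[ℂ] E) :=
    (fun v : X => ContinuousLinearMap.apply ℂ E v) '' closedBall 0 1 with hS
  have hmem : ∀ z ∈ ball (0 : ℂ) (s / 2 / (‖u‖ + 1)), y + z • u ∈ ball y (s / 2) :=
    fun z hz => add_smul_mem_ball hz
  refine differentiableAt_of_norming (S := S) (c := (0 : ℂ)) (R := s / 2 / (‖u‖ + 1))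
    (C := C * (2 / (s / 2))) ?_ ?_ (by positivity) ?_ ?_
  · rintro _ ⟨v, hv, rfl⟩
    refine ContinuousLinearMap.opNorm_le_bound _ zero_le_one fun A => ?_
    have hv' : ‖v‖ ≤ 1 := by simpa using hv
    calc ‖A v‖ ≤ ‖A‖ * ‖v‖ := A.le_opNorm v
      _ ≤ ‖A‖ * 1 := by gcongr
      _ = 1 * ‖A‖ := by ring
  · intro A M hM hA
    refine ContinuousLinearMap.opNorm_le_of_unit_norm hM fun v hv => ?_
    exact hA _ ⟨v, by simpa using hv.le, rfl⟩
  · intro z hz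
    refine h.norm_fderiv_le hs2 hb _ ?_
    have := hmem z hz
    rwa [sub_half]
  · rintro _ ⟨v, hv, rfl⟩
    exact (h.fderiv_apply hb v).differentiableOn_line fun z hz =>
      ball_subset_ball (by linarith) (hmem z hz)

/-- All iterated derivatives of a bounded Gateaux-holomorphic map are Gateaux-holomorphic and
satisfy Cauchy-type estimates. -/
protected theorem iteratedFDeriv [CompleteSpace E] {x : X} {r C : ℝ}
    (h : GateauxHolomorphicOn F (ball x r)) (hb : ∀ y ∈ ball x r, ‖F y‖ ≤ C) (n : ℕ) :
    GateauxHolomorphicOn (iteratedFDeriv ℂ n F) (ball x r) ∧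
      ∀ s > 0, ∀ y ∈ ball x (r - n * s), ‖iteratedFDeriv ℂ n F y‖ ≤ C * (2 / s) ^ n := by
  induction n with
  | zero =>
    refine ⟨fun y hy u => ?_, fun s hs y hy => ?_⟩
    · exact (continuousMultilinearCurryFin0 ℂ X E).symm.toContinuousLinearEquiv.differentiableAt.comp
        (0 : ℂ) (h y hy u)
    · simpa using hb y (by simpa using hy)
  | succ n ih =>
    obtain ⟨ih1, ih2⟩ := ih
    refine ⟨fun y hy u => ?_, fun s hs y hy => ?_⟩
    · obtain ⟨s, hs, hys⟩ := exists_mem_ball_sub_mul hy n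
      have key := (ih1.mono (ball_sub_mul_subset hs.le n)).fderiv (ih2 s hs) y hys u
      rw [iteratedFDeriv_succ_eq_comp_left]
      exact (continuousMultilinearCurryLeftEquiv ℂ (fun _ : Fin (n + 1) => X)
        E).symm.toContinuousLinearEquiv.differentiableAt.comp (0 : ℂ) key
    · rw [← norm_fderiv_iteratedFDeriv, pow_succ, ← mul_assoc]
      refine (ih1.mono (ball_sub_mul_subset hs.le n)).norm_fderiv_le hs (ih2 s hs) y ?_
      convert hy using 2
      push_cast
      ring

theorem iteratedDeriv_line [CompleteSpace E] {x : X} {r C : ℝ}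
    (h : GateauxHolomorphicOn F (ball x r)) (hb : ∀ y ∈ ball x r, ‖F y‖ ≤ C) (u : X) (n : ℕ) :
    ∀ z : ℂ, x + z • u ∈ ball x r → iteratedDeriv n (fun w : ℂ => F (x + w • u)) z
      = iteratedFDeriv ℂ n F (x + z • u) fun _ => u := by
  induction n with
  | zero => simp
  | succ n ih =>
    intro z hz
    have hopen : IsOpen {w : ℂ | x + w • u ∈ ball x r} :=
      isOpen_ball.preimage (by fun_prop)
    have hev : iteratedDeriv n (fun w : ℂ => F (x + w • u)) =ᶠ[𝓝 z]
        fun w => iteratedFDeriv ℂ n F (x + w • u) fun _ => u :=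
      Filter.eventuallyEq_of_mem (hopen.mem_nhds hz) ih
    have hdiff : DifferentiableAt ℂ (iteratedFDeriv ℂ n F) (x + z • u) := by
      obtain ⟨h1, h2⟩ := h.iteratedFDeriv hb n
      obtain ⟨s, hs, hys⟩ := exists_mem_ball_sub_mul hz n
      exact (h1.mono (ball_sub_mul_subset hs.le n)).differentiableAt_of_mem_ball (h2 s hs) _ hys
    have hl : HasDerivAt (fun w : ℂ => x + w • u) u z := by
      simpa using ((hasDerivAt_id z).smul_const u).const_add x
    have hd := hdiff.hasFDerivAt.comp_hasDerivAt z hl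
    have hd' := ((ContinuousMultilinearMap.apply ℂ (fun _ : Fin n => X) E
      (fun _ => u)).hasFDerivAt).comp_hasDerivAt z hd
    rw [iteratedDeriv_succ, hev.deriv_eq, iteratedFDeriv_succ_apply_left]
    exact hd'.deriv

theorem analyticAt_center [CompleteSpace E] {x : X} {r C : ℝ} (hr : 0 < r)
    (h : GateauxHolomorphicOn F (ball x r)) (hb : ∀ y ∈ ball x r, ‖F y‖ ≤ C) :
    AnalyticAt ℂ F x := by
  have hC : 0 ≤ C := (norm_nonneg _).trans (hb x (mem_ball_self hr))
  let p : FormalMultilinearSeries ℂ X E := fun n =>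
    ((n.factorial : ℂ)⁻¹) • iteratedFDeriv ℂ n F x
  set ρ : ℝ := r / (2 * Real.exp 1) with hρ
  have hρ0 : 0 < ρ := by positivity
  have hρr : ρ < r := by
    rw [hρ, div_lt_iff₀ (by positivity)]
    have := Real.add_one_le_exp (1 : ℝ)
    nlinarith
  have hp : ∀ n, ‖p n‖ * ρ ^ n ≤ C * Real.exp 1 := by
    intro n
    have h1 := (h.iteratedFDeriv hb n).2 (r / (n + 1)) (by positivity) x (by
      apply mem_ball_self
      rw [sub_pos, mul_div_assoc', div_lt_iff₀ (by positivity)]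
      nlinarith)
    have h2 := Real.pow_div_factorial_le_exp (n + 1 : ℝ) (by positivity) n
    have h3 : Real.exp (n + 1 : ℝ) = Real.exp 1 ^ n * Real.exp 1 := by
      rw [Real.exp_add, ← Real.exp_nat_mul, mul_one]
    rw [h3] at h2
    calc ‖p n‖ * ρ ^ n
        = (n.factorial : ℝ)⁻¹ * ‖iteratedFDeriv ℂ n F x‖ * ρ ^ n := by
          simp [p, norm_smul]
      _ ≤ (n.factorial : ℝ)⁻¹ * (C * (2 / (r / (n + 1))) ^ n) * ρ ^ n := by gcongr
      _ = C * ((n + 1 : ℝ) ^ n / n.factorial) / Real.exp 1 ^ n := by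
          rw [hρ, div_pow, div_pow, div_pow, mul_pow]
          field_simp
      _ ≤ C * (Real.exp 1 ^ n * Real.exp 1) / Real.exp 1 ^ n := by gcongr
      _ = C * Real.exp 1 := by field_simp
  lift ρ to NNReal using hρ0.le with ρ'
  refine HasFPowerSeriesAt.analyticAt (p := p) ⟨ρ', p.le_radius_of_bound _ hp, by
    exact_mod_cast hρ0, fun {y} hy => ?_⟩
  have hyρ : ‖y‖ < ρ' := by
    rw [Metric.eball_coe] at hy
    simpa using hy
  obtain ⟨t, ht1, ht⟩ : ∃ t : ℝ, 1 < t ∧ t * ‖y‖ < r := by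
    have ht : ∀ᶠ t in 𝓝[>] (1 : ℝ), t * ‖y‖ < r :=
      (Continuous.tendsto' (by fun_prop : Continuous fun t : ℝ => t * ‖y‖) 1 ‖y‖
        (one_mul _)).mono_left nhdsWithin_le_nhds |>.eventually_lt_const (hyρ.trans hρr)
    obtain ⟨t, h1, h2⟩ := (ht.and self_mem_nhdsWithin).exists
    exact ⟨t, h2, h1⟩
  have hmem : ∀ z ∈ ball (0 : ℂ) t, x + z • y ∈ ball x r := by
    intro z hz
    have hz' : ‖z‖ < t := by simpa using hz
    rw [mem_ball, dist_eq_norm, add_sub_cancel_left, norm_smul]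
    exact (mul_le_mul_of_nonneg_right hz'.le (norm_nonneg y)).trans_lt ht
  have key := Complex.hasSum_taylorSeries_on_ball (h.differentiableOn_line hmem)
    (z := 1) (by simpa using ht1)
  simp only [one_smul] at key
  refine key.congr_fun fun n => ?_
  rw [h.iteratedDeriv_line hb y n 0 (by simpa using hr)]
  simp [p]

end GateauxHolomorphicOn
end Gateaux

/-- Theorem 4.1 of the paper.
A map `F` from a domain `O` in a complex Banach space `X` to a complex Banach space `Y`
is complex-analytic (locally given by convergent power series, Mathlib's `AnalyticOnNhd ℂ`)
if and only if it is locally bounded and weakly analytic: for each `x ∈ O`, `u ∈ X` and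
continuous linear functional `ξ` on `Y`, there is `ε > 0` such that
`z ↦ ξ (F (x + z • u))` is analytic on the disc `{z : ℂ | |z| < ε}`. -/
theorem stmt0 {X Y : Type*}
    [NormedAddCommGroup X] [NormedSpace ℂ X] [CompleteSpace X]
    [NormedAddCommGroup Y] [NormedSpace ℂ Y] [CompleteSpace Y]
    (O : Set X) (hO : IsOpen O) (F : X → Y) :
    AnalyticOnNhd ℂ F O ↔
      ((∀ x ∈ O, ∃ U ∈ nhds x, ∃ C : ℝ, ∀ y ∈ U, ‖F y‖ ≤ C) ∧
        ∀ x ∈ O, ∀ u : X, ∀ ξ : Y →L[ℂ] ℂ,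
          ∃ ε > (0 : ℝ),
            AnalyticOnNhd ℂ (fun z : ℂ => ξ (F (x + z • u))) (Metric.ball (0 : ℂ) ε)) := by
  constructor
  · intro hF
    refine ⟨fun x hx => ?_, fun x hx u ξ => ?_⟩
    · refine ⟨{y | ‖F y‖ < ‖F x‖ + 1}, ?_, ‖F x‖ + 1, fun y hy => le_of_lt hy⟩
      exact (hF x hx).continuousAt.norm.eventually_lt_const (lt_add_one _)
    · obtain ⟨ε, hε, hsub⟩ := Metric.isOpen_iff.mp
        (hO.preimage (by fun_prop : Continuous fun z : ℂ => x + z • u)) 0 (by simpa using hx)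
      refine ⟨ε, hε, fun z hz => ?_⟩
      exact (ξ.analyticAt _).comp ((hF _ (hsub hz)).comp_of_eq (by fun_prop) rfl)
  · rintro ⟨hbdd, hweak⟩ x hx
    obtain ⟨U, hU, C, hC⟩ := hbdd x hx
    obtain ⟨r, hr, hsub⟩ := Metric.mem_nhds_iff.mp (Filter.inter_mem hU (hO.mem_nhds hx))
    refine GateauxHolomorphicOn.analyticAt_center hr (fun y hy u => ?_)
      fun y hy => hC y (hsub hy).1
    obtain ⟨s, hs, hsub'⟩ := Metric.isOpen_iff.mp isOpen_ball y hy
    have hmem : ∀ z ∈ ball (0 : ℂ) (s / (‖u‖ + 1)), y + z • u ∈ ball x r := fun z hz =>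
      hsub' (GateauxHolomorphicOn.add_smul_mem_ball hz)
    refine differentiableAt_of_norming (S := {ξ : Y →L[ℂ] ℂ | ‖ξ‖ ≤ 1}) (fun ξ hξ => hξ) ?_
      (by positivity) (fun z hz => hC _ (hsub (hmem z hz)).1) ?_
    · intro e M hM he
      obtain ⟨ξ, hξ, hξe⟩ := exists_dual_vector'' ℂ e
      simpa [hξe] using he ξ hξ
    · intro ξ _
      refine GateauxHolomorphicOn.differentiableOn_line (F := fun p => ξ (F p)) (U := ball x r)
        (fun p hp v => ?_) hmem
      obtain ⟨ε, hε, hξ⟩ := hweak p (hsub hp).2 v ξ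
      exact (hξ 0 (mem_ball_self hε)).differentiableAt
end

section
/- Let O₁, O₂ be open subsets of complex Banach spaces X₁, X₂ and Y a complex Banach space. A map F : O₁ × O₂ → Y is complex-analytic if and only if it is locally bounded and separately analytic, i.e., for each fixed x₂ ∈ O₂ the map x ↦ F(x, x₂) is analytic on O₁ and for each fixed x₁ ∈ O₁ the map x' ↦ F(x₁, x') is analytic on O₂. -/
open Metric Set Filter Topology

theorem ball_subset_ball_of_mem_half {E : Type*} [PseudoMetricSpace E] {c x : E} {r : ℝ}
    (hx : x ∈ ball c (r / 2)) :
    ball x (r / 2) ⊆ ball c r :=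
  ball_subset_ball' (by linarith [mem_ball.mp hx])

section Holomorphic

variable {E G : Type*} [NormedAddCommGroup E] [NormedSpace ℂ E]
  [NormedAddCommGroup G] [NormedSpace ℂ G]

/-- The **Cauchy estimate** for the derivative of a bounded holomorphic map on a ball. -/
theorem norm_fderiv_le_of_norm_le_on_ball {f : E → G} {c : E} {r M : ℝ} (hr : 0 < r)
    (hd : DifferentiableOn ℂ f (ball c r)) (hM : ∀ x ∈ ball c r, ‖f x‖ ≤ M) :
    ‖fderiv ℂ f c‖ ≤ 2 * M / r := by
  refine Complex.norm_fderiv_le_div_of_mapsTo_ball hd (fun x hx => ?_) hr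
  rw [mem_closedBall, dist_eq_norm]
  linarith [norm_sub_le (f x) (f c), hM x hx, hM c (mem_ball_self hr)]

/-- Second-order Taylor estimate for a bounded holomorphic map on a ball. -/
theorem norm_sub_sub_fderiv_le_of_norm_le_on_ball {f : E → G} {c : E} {r M : ℝ} (hr : 0 < r)
    (hd : DifferentiableOn ℂ f (ball c r)) (hM : ∀ x ∈ ball c r, ‖f x‖ ≤ M)
    {z : E} (hz : z ∈ ball c r) :
    ‖f z - f c - fderiv ℂ f c (z - c)‖ ≤ 4 * M * (‖z - c‖ / r) ^ 2 := by
  have hC := norm_fderiv_le_of_norm_le_on_ball hr hd hM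
  have hfc : DifferentiableAt ℂ f c := hd.differentiableAt (ball_mem_nhds c hr)
  have hM0 : 0 ≤ M := (norm_nonneg _).trans (hM c (mem_ball_self hr))
  have key := Complex.dist_le_mul_div_pow_of_mapsTo_ball_of_isLittleO (n := 1) (R₂ := 4 * M)
    (f := fun z => f z - f c - fderiv ℂ f c (z - c)) (c := c) (R₁ := r)
    ((hd.sub_const _).sub (by fun_prop)) (fun x hx => ?_) ?_ hz
  · simpa [dist_eq_norm] using key
  · have h1 := (fderiv ℂ f c).le_of_opNorm_le hC (x - c)
    have h2 : 2 * M / r * ‖x - c‖ ≤ 2 * M / r * r := by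
      gcongr
      exact (mem_ball_iff_norm.mp hx).le
    rw [div_mul_cancel₀ _ hr.ne'] at h2
    simp only [sub_self, map_zero, mem_closedBall, dist_eq_norm, sub_zero]
    linarith [norm_sub_le (f x - f c) (fderiv ℂ f c (x - c)), norm_sub_le (f x) (f c), hM x hx,
      hM c (mem_ball_self hr)]
  · simpa using hfc.hasFDerivAt.isLittleO.norm_right

theorem hasFDerivAt_of_eventually_norm_le_sq {f : E → G} {A : E →L[ℂ] G} {c : E} (K : ℝ)
    (h : ∀ᶠ z in 𝓝 c, ‖f z - f c - A (z - c)‖ ≤ K * ‖z - c‖ ^ 2) : HasFDerivAt f A c := by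
  have hO : (fun z => f z - f c - A (z - c)) =O[𝓝 c] fun z => ‖z - c‖ ^ 2 :=
    Asymptotics.IsBigO.of_bound K (by simpa using h)
  have := hO.hasFDerivAt (𝕜 := ℂ) one_lt_two
  have h2 := (this.add_const (f c)).add (A.hasFDerivAt.comp c ((hasFDerivAt_id c).sub_const c))
  convert h2 using 1
  · ext z
    simp only [Pi.add_apply, Function.comp_apply, id_eq]
    abel
  · ext z
    simp

/-- A bounded uniform limit of holomorphic maps on a ball is differentiable at the center. -/
theorem differentiableAt_of_tendstoUniformlyOn_ball [CompleteSpace G] {g : ℕ → E → G} {f : E → G}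
    {c : E} {r M : ℝ} (hr : 0 < r) (hg : ∀ n, DifferentiableOn ℂ (g n) (ball c r))
    (hM : ∀ x ∈ ball c r, ‖f x‖ ≤ M) (hgf : TendstoUniformlyOn g f atTop (ball c r)) :
    DifferentiableAt ℂ f c := by
  have hcauchy : CauchySeq fun n => fderiv ℂ (g n) c := by
    rw [Metric.cauchySeq_iff]
    intro ε hε
    obtain ⟨N, hN⟩ := Metric.uniformCauchySeqOn_iff.mp hgf.uniformCauchySeqOn (ε * r / 4)
      (by positivity)
    refine ⟨N, fun m hm n hn => ?_⟩
    have hb := norm_fderiv_le_of_norm_le_on_ball hr ((hg m).sub (hg n)) (M := ε * r / 4)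
      (fun x hx => by simpa [dist_eq_norm] using (hN m hm n hn x hx).le)
    rw [fderiv_sub ((hg m).differentiableAt (ball_mem_nhds c hr))
      ((hg n).differentiableAt (ball_mem_nhds c hr))] at hb
    rw [dist_eq_norm]
    refine hb.trans_lt ?_
    rw [div_lt_iff₀ hr]
    nlinarith [mul_pos hε hr]
  obtain ⟨A, hA⟩ := cauchySeq_tendsto_of_complete hcauchy
  refine (hasFDerivAt_of_eventually_norm_le_sq (A := A) (4 * (M + 1) / r ^ 2) ?_).differentiableAt
  filter_upwards [ball_mem_nhds c hr] with z hz
  have hlim : Tendsto (fun n => ‖g n z - g n c - fderiv ℂ (g n) c (z - c)‖) atTop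
      (𝓝 ‖f z - f c - A (z - c)‖) :=
    (((hgf.tendsto_at hz).sub (hgf.tendsto_at (mem_ball_self hr))).sub
      (((ContinuousLinearMap.apply ℂ G (z - c)).continuous.tendsto A).comp hA)).norm
  refine le_of_tendsto hlim ?_
  filter_upwards [Metric.tendstoUniformlyOn_iff.mp hgf 1 one_pos] with n hn
  refine (norm_sub_sub_fderiv_le_of_norm_le_on_ball hr (hg n) (M := M + 1)
    (fun x hx => ?_) hz).trans_eq (by ring)
  have h1 := hn x hx
  rw [dist_eq_norm'] at h1
  linarith [norm_le_norm_add_norm_sub' (g n x) (f x), hM x hx]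

/-- The derivative, applied to a fixed vector, of a holomorphic map is holomorphic. -/
theorem differentiableAt_fderiv_apply [CompleteSpace G] {f : E → G} {c : E} {r M : ℝ} (hr : 0 < r)
    (hd : DifferentiableOn ℂ f (ball c r)) (hM : ∀ x ∈ ball c r, ‖f x‖ ≤ M) (v : E) :
    DifferentiableAt ℂ (fun x => fderiv ℂ f x v) c := by
  have hM0 : 0 ≤ M := (norm_nonneg _).trans (hM c (mem_ball_self hr))
  have hr2 : 0 < r / 2 := half_pos hr
  set s : ℝ := r / (2 * (‖v‖ + 1)) with hs
  have hs0 : 0 < s := by positivity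
  have hsv : s * ‖v‖ < r / 2 := by
    rw [hs, div_mul_eq_mul_div, div_lt_div_iff₀ (by positivity) two_pos]
    nlinarith [norm_nonneg v]
  set t : ℕ → ℝ := fun n => s / (n + 1) with ht
  have ht0 : ∀ n, 0 < t n := fun n => by positivity
  have hts : ∀ n, t n ≤ s := fun n => div_le_self hs0.le (by simp)
  have htv : ∀ n, ‖(t n : ℂ) • v‖ < r / 2 := fun n => by
    rw [norm_smul, Complex.norm_real, Real.norm_of_nonneg (ht0 n).le]
    exact (mul_le_mul_of_nonneg_right (hts n) (norm_nonneg v)).trans_lt hsv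
  have hmem : ∀ n, ∀ x ∈ ball c (r / 2), x + (t n : ℂ) • v ∈ ball x (r / 2) := fun n x _ => by
    simpa [mem_ball_iff_norm] using htv n
  refine differentiableAt_of_tendstoUniformlyOn_ball (r := r / 2)
    (M := 2 * M / (r / 2) * ‖v‖)
    (g := fun n x => (t n : ℂ)⁻¹ • (f (x + (t n : ℂ) • v) - f x)) hr2 (fun n => ?_)
    (fun x hx => ?_) ?_
  · refine DifferentiableOn.const_smul (DifferentiableOn.sub ?_ (hd.mono ?_)) _
    · exact hd.comp (by fun_prop) fun x hx => ball_subset_ball_of_mem_half hx (hmem n x hx)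
    · exact ball_subset_ball (by linarith)
  · exact (fderiv ℂ f x).le_of_opNorm_le (norm_fderiv_le_of_norm_le_on_ball hr2
      (hd.mono (ball_subset_ball_of_mem_half hx))
      fun y hy => hM y (ball_subset_ball_of_mem_half hx hy)) v
  · have hbound : ∀ n, ∀ x ∈ ball c (r / 2),
        ‖fderiv ℂ f x v - (t n : ℂ)⁻¹ • (f (x + (t n : ℂ) • v) - f x)‖
          ≤ 4 * M * (‖v‖ / (r / 2)) ^ 2 * t n := by
      intro n x hx
      have hq := norm_sub_sub_fderiv_le_of_norm_le_on_ball hr2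
        (hd.mono (ball_subset_ball_of_mem_half hx))
        (fun y hy => hM y (ball_subset_ball_of_mem_half hx hy)) (hmem n x hx)
      rw [add_sub_cancel_left, map_smul, norm_smul, Complex.norm_real,
        Real.norm_of_nonneg (ht0 n).le] at hq
      have htn : (t n : ℂ) ≠ 0 := by exact_mod_cast (ht0 n).ne'
      have heq : fderiv ℂ f x v - (t n : ℂ)⁻¹ • (f (x + (t n : ℂ) • v) - f x) =
          -((t n : ℂ)⁻¹ • (f (x + (t n : ℂ) • v) - f x - (t n : ℂ) • fderiv ℂ f x v)) := by
        rw [smul_sub _ (f (x + (t n : ℂ) • v) - f x), smul_smul, inv_mul_cancel₀ htn, one_smul]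
        abel
      rw [heq, norm_neg, norm_smul, norm_inv, Complex.norm_real,
        Real.norm_of_nonneg (ht0 n).le, inv_mul_le_iff₀ (ht0 n)]
      refine hq.trans_eq (by ring)
    have htlim : Tendsto (fun n => 4 * M * (‖v‖ / (r / 2)) ^ 2 * t n) atTop (𝓝 0) := by
      have h0 : Tendsto t atTop (𝓝 0) := by
        have := (tendsto_one_div_add_atTop_nhds_zero_nat (𝕜 := ℝ)).const_mul s
        simpa [ht, div_eq_mul_inv] using this
      simpa using h0.const_mul (4 * M * (‖v‖ / (r / 2)) ^ 2)
    rw [Metric.tendstoUniformlyOn_iff]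
    intro ε hε
    filter_upwards [htlim.eventually_lt_const hε] with n hn x hx
    rw [dist_eq_norm]
    exact (hbound n x hx).trans_lt hn

/-- The derivative of a holomorphic map on a ball, bounded there, is differentiable at the
center. -/
theorem differentiableAt_fderiv_of_norm_le_on_ball [CompleteSpace G] {f : E → G} {c : E} {r M : ℝ}
    (hr : 0 < r) (hd : DifferentiableOn ℂ f (ball c r)) (hM : ∀ x ∈ ball c r, ‖f x‖ ≤ M) :
    DifferentiableAt ℂ (fderiv ℂ f) c := by
  have hr2 : 0 < r / 2 := half_pos hr
  have hM0 : 0 ≤ M := (norm_nonneg _).trans (hM c (mem_ball_self hr))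
  have hdv : ∀ v, ∀ x ∈ ball c (r / 2), DifferentiableAt ℂ (fun x => fderiv ℂ f x v) x :=
    fun v x hx => differentiableAt_fderiv_apply hr2
      (hd.mono (ball_subset_ball_of_mem_half hx))
      (fun y hy => hM y (ball_subset_ball_of_mem_half hx hy)) v
  have hbv : ∀ v, ∀ x ∈ ball c (r / 2), ‖fderiv ℂ f x v‖ ≤ 2 * M / (r / 2) * ‖v‖ :=
    fun v x hx => (fderiv ℂ f x).le_of_opNorm_le (norm_fderiv_le_of_norm_le_on_ball hr2
      (hd.mono (ball_subset_ball_of_mem_half hx))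
      fun y hy => hM y (ball_subset_ball_of_mem_half hx hy)) v
  have hc : c ∈ ball c (r / 2) := mem_ball_self hr2
  let B : E →L[ℂ] E →L[ℂ] G := LinearMap.mkContinuous₂
    (LinearMap.mk₂ ℂ (fun w v => fderiv ℂ (fun x => fderiv ℂ f x v) c w)
      (fun w w' v => map_add _ w w') (fun a w v => map_smul _ a w)
      (fun w v v' => by
        simp only [map_add]
        rw [fderiv_fun_add (hdv v c hc) (hdv v' c hc)]; rfl)
      (fun a w v => by
        simp only [map_smul]
        rw [fderiv_fun_const_smul (hdv v c hc)]; rfl))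
    (2 * (2 * M / (r / 2)) / (r / 2)) (fun w v => by
      rw [LinearMap.mk₂_apply]
      refine ((fderiv ℂ (fun x => fderiv ℂ f x v) c).le_of_opNorm_le
        (norm_fderiv_le_of_norm_le_on_ball hr2
          (fun x hx => (hdv v x hx).differentiableWithinAt) (hbv v)) w).trans_eq (by ring))
  have hB : ∀ w v, B w v = fderiv ℂ (fun x => fderiv ℂ f x v) c w := fun w v => rfl
  refine (hasFDerivAt_of_eventually_norm_le_sq (A := B)
    (4 * (2 * M / (r / 2)) / (r / 2) ^ 2) ?_).differentiableAt
  filter_upwards [ball_mem_nhds c hr2] with z hz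
  refine ContinuousLinearMap.opNorm_le_bound _ (by positivity) fun v => ?_
  refine (norm_sub_sub_fderiv_le_of_norm_le_on_ball hr2
    (fun x hx => (hdv v x hx).differentiableWithinAt) (hbv v) hz).trans_eq (by ring)

theorem DifferentiableOn.fderiv_of_isOpen [CompleteSpace G] {f : E → G} {U : Set E}
    (hU : IsOpen U) (hf : DifferentiableOn ℂ f U) : DifferentiableOn ℂ (fderiv ℂ f) U := by
  intro x hx
  have hxU := hU.mem_nhds hx
  have hbd : ∀ᶠ y in 𝓝 x, ‖f y‖ < ‖f x‖ + 1 :=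
    (hf.differentiableAt hxU).continuousAt.norm.eventually_lt_const (lt_add_one _)
  obtain ⟨r, hr, hsub⟩ := Metric.mem_nhds_iff.mp (hbd.and hxU)
  exact (differentiableAt_fderiv_of_norm_le_on_ball hr (hf.mono fun y hy => (hsub hy).2)
    fun y hy => (hsub hy).1.le).differentiableWithinAt

theorem DifferentiableOn.clm_comp_fderiv_of_isOpen [CompleteSpace G] {H : Type*}
    [NormedAddCommGroup H] [NormedSpace ℂ H] {f : E → G} {U : Set E} (hU : IsOpen U)
    (hf : DifferentiableOn ℂ f U) (L : (E →L[ℂ] G) →L[ℂ] H) :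
    DifferentiableOn ℂ (fun x => L (fderiv ℂ f x)) U :=
  L.differentiable.comp_differentiableOn (hf.fderiv_of_isOpen hU)

theorem DifferentiableOn.iteratedFDeriv_of_isOpen [CompleteSpace G] {f : E → G} {U : Set E}
    (hU : IsOpen U) (hf : DifferentiableOn ℂ f U) (n : ℕ) :
    DifferentiableOn ℂ (iteratedFDeriv ℂ n f) U := by
  induction n with
  | zero =>
    rw [iteratedFDeriv_zero_eq_comp]
    exact (LinearIsometryEquiv.differentiable _).comp_differentiableOn hf
  | succ n ih =>
    exact ih.clm_comp_fderiv_of_isOpen hU ((continuousMultilinearCurryLeftEquiv ℂ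
      (fun _ : Fin (n + 1) => E) G).symm.toContinuousLinearEquiv :
        (E →L[ℂ] (E [×n]→L[ℂ] G)) →L[ℂ] (E [×(n + 1)]→L[ℂ] G))

/-- Iterated Cauchy estimates. -/
theorem norm_iteratedFDeriv_le_of_norm_le_on_isOpen [CompleteSpace G] {f : E → G} {U : Set E}
    {M δ : ℝ} (hU : IsOpen U) (hf : DifferentiableOn ℂ f U) (hM : ∀ x ∈ U, ‖f x‖ ≤ M)
    (hδ : 0 < δ) (n : ℕ) (x : E) (hx : ball x (n * δ) ⊆ U) (hxU : x ∈ U) :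
    ‖iteratedFDeriv ℂ n f x‖ ≤ M * (2 / δ) ^ n := by
  induction n generalizing x with
  | zero => simpa using hM x hxU
  | succ n ih =>
    have hsub : ∀ y ∈ ball x δ, ball y (n * δ) ⊆ ball x ((n + 1 : ℕ) * δ) := fun y hy =>
      ball_subset_ball' (by push_cast; linarith [mem_ball.mp hy])
    have hδU : ball x δ ⊆ U :=
      (ball_subset_ball (le_mul_of_one_le_left hδ.le (by simp))).trans hx
    rw [← norm_fderiv_iteratedFDeriv]
    refine (norm_fderiv_le_of_norm_le_on_ball hδ
      ((hf.iteratedFDeriv_of_isOpen hU n).mono hδU)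
      fun y hy => ih y ((hsub y hy).trans hx) (hδU hy)).trans_eq ?_
    rw [pow_succ]
    ring

theorem iteratedDeriv_comp_add_smul [CompleteSpace G] {f : E → G} {U : Set E}
    (hU : IsOpen U) (hf : DifferentiableOn ℂ f U) (a y : E) (n : ℕ) (z : ℂ) (hz : a + z • y ∈ U) :
    iteratedDeriv n (fun z : ℂ => f (a + z • y)) z =
      iteratedFDeriv ℂ n f (a + z • y) (fun _ => y) := by
  induction n generalizing z with
  | zero => simp
  | succ n ih =>
    have hev : iteratedDeriv n (fun z : ℂ => f (a + z • y)) =ᶠ[𝓝 z]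
        fun z => iteratedFDeriv ℂ n f (a + z • y) (fun _ => y) := by
      have hc : ContinuousAt (fun z : ℂ => a + z • y) z := by fun_prop
      filter_upwards [hc.preimage_mem_nhds (hU.mem_nhds hz)] with w hw using ih w hw
    rw [iteratedDeriv_succ, hev.deriv_eq]
    have hline : HasDerivAt (fun z : ℂ => a + z • y) y z := by
      simpa using ((hasDerivAt_id z).smul_const y).const_add a
    have h1 := (((hf.iteratedFDeriv_of_isOpen hU n).differentiableAt
      (hU.mem_nhds hz)).hasFDerivAt).comp_hasDerivAt z hline
    have h2 := (ContinuousMultilinearMap.apply ℂ (fun _ : Fin n => E) G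
      (fun _ => y)).hasFDerivAt.comp_hasDerivAt z h1
    exact h2.deriv

/-- **Goursat's theorem** in normed spaces: a complex Fréchet differentiable map on an open set
is analytic. -/
theorem DifferentiableOn.analyticOnNhd_of_isOpen [CompleteSpace G] {f : E → G} {U : Set E}
    (hU : IsOpen U) (hf : DifferentiableOn ℂ f U) : AnalyticOnNhd ℂ f U := by
  intro a ha
  have haU := hU.mem_nhds ha
  have hbd : ∀ᶠ y in 𝓝 a, ‖f y‖ < ‖f a‖ + 1 :=
    (hf.differentiableAt haU).continuousAt.norm.eventually_lt_const (lt_add_one _)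
  obtain ⟨r, hr, hsub⟩ := Metric.mem_nhds_iff.mp (hbd.and haU)
  have hd : DifferentiableOn ℂ f (ball a r) := hf.mono fun y hy => (hsub hy).2
  have hM : ∀ y ∈ ball a r, ‖f y‖ ≤ ‖f a‖ + 1 := fun y hy => (hsub hy).1.le
  set M := ‖f a‖ + 1
  have hM0 : 0 ≤ M := by positivity
  let p : FormalMultilinearSeries ℂ E G := fun n =>
    ((n.factorial : ℂ)⁻¹) • iteratedFDeriv ℂ n f a
  have hp : ∀ n, ‖p n‖ ≤ M * (2 * Real.exp 1 / r) ^ n := by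
    intro n
    rcases Nat.eq_zero_or_pos n with rfl | hn
    · simpa [p] using hM a (mem_ball_self hr)
    have hn' : (0 : ℝ) < n := by exact_mod_cast hn
    have h1 := norm_iteratedFDeriv_le_of_norm_le_on_isOpen isOpen_ball hd hM
      (δ := r / n) (by positivity) n a (by rw [mul_div_cancel₀ _ hn'.ne']) (mem_ball_self hr)
    have h2 := Real.pow_div_factorial_le_exp (n : ℝ) hn'.le n
    rw [← mul_one (n : ℝ), Real.exp_nat_mul, mul_one] at h2
    calc ‖p n‖ = (n.factorial : ℝ)⁻¹ * ‖iteratedFDeriv ℂ n f a‖ := by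
          simp [p, norm_smul]
      _ ≤ (n.factorial : ℝ)⁻¹ * (M * (2 / (r / n)) ^ n) := by gcongr
      _ = M * (2 / r) ^ n * ((n : ℝ) ^ n / n.factorial) := by
          rw [div_div_eq_mul_div, mul_div_right_comm, mul_pow]; ring
      _ ≤ M * (2 / r) ^ n * Real.exp 1 ^ n := by gcongr
      _ = M * (2 * Real.exp 1 / r) ^ n := by rw [mul_div_right_comm, mul_pow, mul_assoc]
  have he : 1 ≤ Real.exp 1 := Real.one_le_exp zero_le_one
  let ρ : NNReal := ⟨r / (2 * Real.exp 1), by positivity⟩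
  have hρ : (ρ : ℝ) = r / (2 * Real.exp 1) := rfl
  have hρr : (ρ : ℝ) ≤ r := by rw [hρ]; exact div_le_self hr.le (by linarith)
  refine ⟨p, ρ, ⟨p.le_radius_of_bound M fun n => ?_, ?_, fun {y} hy => ?_⟩⟩
  · calc ‖p n‖ * (ρ : ℝ) ^ n ≤ M * (2 * Real.exp 1 / r) ^ n * (ρ : ℝ) ^ n := by gcongr; exact hp n
      _ = M := by rw [mul_assoc, ← mul_pow, hρ]; field_simp; simp
  · have : (0 : ℝ) < ρ := by rw [hρ]; positivity
    exact_mod_cast this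
  · rw [Metric.eball_coe, mem_ball_zero_iff] at hy
    have hyr : ‖y‖ < r := hy.trans_le hρr
    obtain ⟨R, hR1, hRy⟩ : ∃ R : ℝ, 1 < R ∧ R * ‖y‖ < r := by
      have hc : ContinuousAt (fun R : ℝ => R * ‖y‖) 1 := by fun_prop
      have hlt : ∀ᶠ R in 𝓝[>] (1 : ℝ), R * ‖y‖ < r :=
        (hc.eventually_lt_const (by simpa using hyr)).filter_mono nhdsWithin_le_nhds
      exact (eventually_mem_nhdsWithin.and hlt).exists
    have hline : MapsTo (fun z : ℂ => a + z • y) (ball 0 R) (ball a r) := fun z hz => by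
      rw [mem_ball_zero_iff] at hz
      rw [mem_ball_iff_norm, add_sub_cancel_left, norm_smul]
      exact (mul_le_mul_of_nonneg_right hz.le (norm_nonneg y)).trans_lt hRy
    have hsum := Complex.hasSum_taylorSeries_on_ball (c := 0) (r := R) (z := 1)
      (f := fun z : ℂ => f (a + z • y)) (hd.comp (by fun_prop) hline) (by simpa using hR1)
    have haux := fun n => iteratedDeriv_comp_add_smul isOpen_ball hd a y n 0
      (by simpa using hr)
    simpa [haux, p] using hsum

end Holomorphic

/-- **Osgood's lemma** in normed spaces: a locally bounded, separately holomorphic map is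
jointly differentiable. -/
theorem differentiableAt_of_separately {E₁ E₂ G : Type*}
    [NormedAddCommGroup E₁] [NormedSpace ℂ E₁] [NormedAddCommGroup E₂] [NormedSpace ℂ E₂]
    [NormedAddCommGroup G] [NormedSpace ℂ G] {F : E₁ × E₂ → G} {a : E₁} {b : E₂} {r M : ℝ}
    (hr : 0 < r) (hM : ∀ x ∈ ball a r, ∀ y ∈ ball b r, ‖F (x, y)‖ ≤ M)
    (h1 : ∀ y ∈ ball b r, DifferentiableOn ℂ (fun x => F (x, y)) (ball a r))
    (h2 : ∀ x ∈ ball a r, DifferentiableOn ℂ (fun y => F (x, y)) (ball b r)) :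
    DifferentiableAt ℂ F (a, b) := by
  have ha : a ∈ ball a r := mem_ball_self hr
  have hb : b ∈ ball b r := mem_ball_self hr
  have hM0 : 0 ≤ M := (norm_nonneg _).trans (hM a ha b hb)
  let D : E₂ → E₁ →L[ℂ] G := fun y => fderiv ℂ (fun x => F (x, y)) a
  let D₂ : E₂ →L[ℂ] G := fderiv ℂ (fun y => F (a, y)) b
  have hD : ∀ y ∈ ball b r, ‖D y - D b‖ ≤ 2 * (2 * M / r * ‖y - b‖) / r := by
    intro y hy
    have hdiff := norm_fderiv_le_of_norm_le_on_ball hr ((h1 y hy).sub (h1 b hb))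
      (M := 2 * M / r * ‖y - b‖) fun x hx => by
        have := Complex.dist_le_div_mul_dist_of_mapsTo_ball (R₂ := 2 * M) (h2 x hx)
          (fun w hw => by
            rw [mem_closedBall, dist_eq_norm]
            linarith [norm_sub_le (F (x, w)) (F (x, b)), hM x hx w hw, hM x hx b hb]) hy
        simpa [dist_eq_norm] using this
    rwa [fderiv_sub ((h1 y hy).differentiableAt (ball_mem_nhds a hr))
      ((h1 b hb).differentiableAt (ball_mem_nhds a hr))] at hdiff
  refine (hasFDerivAt_of_eventually_norm_le_sq (A := (D b).coprod D₂)
    (12 * M / r ^ 2) ?_).differentiableAt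
  filter_upwards [prod_mem_nhds (ball_mem_nhds a hr) (ball_mem_nhds b hr)]
  rintro ⟨x, y⟩ ⟨hx, hy⟩
  have e1 := norm_sub_sub_fderiv_le_of_norm_le_on_ball hr (h1 y hy) (fun x hx => hM x hx y hy) hx
  have e2 := (D y - D b).le_of_opNorm_le (hD y hy) (x - a)
  have e3 := norm_sub_sub_fderiv_le_of_norm_le_on_ball hr (h2 a ha) (hM a ha) hy
  have hxn : ‖x - a‖ ≤ ‖(x, y) - (a, b)‖ := norm_fst_le ((x, y) - (a, b))
  have hyn : ‖y - b‖ ≤ ‖(x, y) - (a, b)‖ := norm_snd_le ((x, y) - (a, b))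
  set N := ‖(x, y) - (a, b)‖
  have e1' : 4 * M * (‖x - a‖ / r) ^ 2 ≤ 4 * M * (N / r) ^ 2 := by gcongr
  have e2' : 2 * (2 * M / r * ‖y - b‖) / r * ‖x - a‖ ≤ 2 * (2 * M / r * N) / r * N := by gcongr
  have e3' : 4 * M * (‖y - b‖ / r) ^ 2 ≤ 4 * M * (N / r) ^ 2 := by gcongr
  have hsplit : F (x, y) - F (a, b) - (D b).coprod D₂ ((x, y) - (a, b)) =
      (F (x, y) - F (a, y) - D y (x - a)) + (D y - D b) (x - a)
        + (F (a, y) - F (a, b) - D₂ (y - b)) := by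
    simp only [Prod.mk_sub_mk, ContinuousLinearMap.coprod_apply, sub_apply]
    abel
  rw [hsplit]
  calc _ ≤ 4 * M * (N / r) ^ 2 + 2 * (2 * M / r * N) / r * N + 4 * M * (N / r) ^ 2 :=
        norm_add₃_le.trans (add_le_add (add_le_add (e1.trans e1') (e2.trans e2')) (e3.trans e3'))
    _ = 12 * M / r ^ 2 * N ^ 2 := by field_simp; ring


/-- Corollary 4.4 of the paper.
A map `F : O₁ × O₂ → Y` between complex Banach spaces is complex-analytic if and only
if it is locally bounded and separately analytic in each of the two variables. -/
theorem stmt2 {X₁ X₂ Y : Type*}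
    [NormedAddCommGroup X₁] [NormedSpace ℂ X₁] [CompleteSpace X₁]
    [NormedAddCommGroup X₂] [NormedSpace ℂ X₂] [CompleteSpace X₂]
    [NormedAddCommGroup Y] [NormedSpace ℂ Y] [CompleteSpace Y]
    (O₁ : Set X₁) (O₂ : Set X₂) (h₁ : IsOpen O₁) (h₂ : IsOpen O₂)
    (F : X₁ × X₂ → Y) :
    AnalyticOnNhd ℂ F (O₁ ×ˢ O₂) ↔
      ((∀ p ∈ O₁ ×ˢ O₂, ∃ U ∈ nhds p, ∃ C : ℝ, ∀ q ∈ U, ‖F q‖ ≤ C) ∧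
        (∀ x₂ ∈ O₂, AnalyticOnNhd ℂ (fun x : X₁ => F (x, x₂)) O₁) ∧
        (∀ x₁ ∈ O₁, AnalyticOnNhd ℂ (fun x' : X₂ => F (x₁, x')) O₂)) := by
  constructor
  · intro hF
    refine ⟨fun p hp => ?_, fun x₂ hx₂ x hx => ?_, fun x₁ hx₁ y hy => ?_⟩
    · exact ⟨_, (hF p hp).continuousAt.norm.eventually_lt_const (lt_add_one ‖F p‖), ‖F p‖ + 1,
        fun q hq => le_of_lt hq⟩
    · exact (hF (x, x₂) ⟨hx, hx₂⟩).comp₂ analyticAt_id analyticAt_const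
    · exact (hF (x₁, y) ⟨hx₁, hy⟩).comp₂ analyticAt_const analyticAt_id
  · rintro ⟨hbd, hs₁, hs₂⟩
    refine DifferentiableOn.analyticOnNhd_of_isOpen (h₁.prod h₂) ?_
    rintro ⟨a, b⟩ hp
    obtain ⟨U, hU, M, hM⟩ := hbd (a, b) hp
    obtain ⟨r, hr, hsub⟩ := Metric.mem_nhds_iff.mp
      (Filter.inter_mem hU ((h₁.prod h₂).mem_nhds hp))
    rw [← ball_prod_same] at hsub
    refine (differentiableAt_of_separately hr (fun x hx y hy => hM _ (hsub ⟨hx, hy⟩).1)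
      (fun y hy x hx => ?_) fun x hx y hy => ?_).differentiableWithinAt
    · have hxy := (hsub (mk_mem_prod hx hy)).2
      exact (hs₁ y hxy.2 x hxy.1).differentiableAt.differentiableWithinAt
    · have hxy := (hsub (mk_mem_prod hx hy)).2
      exact (hs₂ x hxy.1 y hxy.2).differentiableAt.differentiableWithinAt
end

section
/- Let s > d/2 and let f(x,u) be continuous on 𝕋^d × Q, where Q is an open neighbourhood of ℝ in ℂ, analytic in u, H^s-smooth in x, and satisfying ‖f(·,u)‖_s ≤ C(R) for all u ∈ Q with |u| < R. Then for each R and sufficiently small δ < R, the composition (Nemytskii) operator F : u(x) ↦ f(x, u(x)) is a complex-analytic map from the domain O(R,δ) = {u ∈ H^s(𝕋^d;ℂ) : ‖u‖_s < R, ‖Im u‖_s < δ} into H^s(𝕋^d;ℂ). -/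
open scoped BigOperators
open MeasureTheory Set Filter

noncomputable section

/-- The `k`-th Fourier coefficient of a function on the torus `𝕋^d = ℝ^d/ℤ^d`
(represented by a `ℤ^d`-periodic function on `ℝ^d`). -/
def tcoeff {d : ℕ} (u : (Fin d → ℝ) → ℂ) (k : Fin d → ℤ) : ℂ :=
  ∫ x in Set.univ.pi (fun _ : Fin d => Set.Ico (0 : ℝ) 1),
    u x * Complex.exp (-2 * Real.pi * Complex.I * (∑ i, (k i : ℂ) * (x i : ℂ)))

/-- The Sobolev weight `(1 + |k|²)^s`. -/
def sobWeight {d : ℕ} (s : ℝ) (k : Fin d → ℤ) : ℝ :=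
  (1 + ∑ i, ((k i : ℝ)) ^ 2) ^ s

/-- Square of the Sobolev `H^s`-norm, via Fourier coefficients. -/
def sobNormSq {d : ℕ} (s : ℝ) (u : (Fin d → ℝ) → ℂ) : ℝ :=
  ∑' k : Fin d → ℤ, sobWeight s k * ‖tcoeff u k‖ ^ 2

/-- The Sobolev `H^s`-norm on the torus. -/
def sobNorm {d : ℕ} (s : ℝ) (u : (Fin d → ℝ) → ℂ) : ℝ :=
  Real.sqrt (sobNormSq s u)

/-- `ℤ^d`-periodicity: the function lives on the torus `𝕋^d`. -/
def ZPeriodic {d : ℕ} {α : Type*} (u : (Fin d → ℝ) → α) : Prop :=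
  ∀ (x : Fin d → ℝ) (i : Fin d), u (x + Pi.single i 1) = u x

/-- Membership in the Sobolev space `H^s(𝕋^d; ℂ)`. -/
def MemHs {d : ℕ} (s : ℝ) (u : (Fin d → ℝ) → ℂ) : Prop :=
  ZPeriodic u ∧ Summable (fun k : Fin d → ℤ => sobWeight s k * ‖tcoeff u k‖ ^ 2)

/-- Membership in the real Sobolev space `H^s(𝕋^d; ℝ)`. -/
def MemHsR {d : ℕ} (s : ℝ) (u : (Fin d → ℝ) → ℝ) : Prop :=
  MemHs s fun x => (u x : ℂ)

/-- `H^s`-norm of a real-valued function. -/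
def sobNormR {d : ℕ} (s : ℝ) (u : (Fin d → ℝ) → ℝ) : ℝ :=
  sobNorm s fun x => (u x : ℂ)

end

open scoped Topology

/-- The exponential monomial `x ↦ exp (2πi k·x)` on `ℝ^d`. -/
noncomputable def texp {d : ℕ} (k : Fin d → ℤ) (x : Fin d → ℝ) : ℂ :=
  Complex.exp (2 * Real.pi * Complex.I * (∑ i, (k i : ℂ) * (x i : ℂ)))

/-- The fundamental cube `[0,1)^d`. -/
def unitCube (d : ℕ) : Set (Fin d → ℝ) := Set.univ.pi (fun _ : Fin d => Set.Ico (0 : ℝ) 1)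

section Exponentials

variable {d : ℕ}

lemma texp_zero : texp (0 : Fin d → ℤ) = 1 := by
  ext x; simp [texp]

lemma texp_add (k l : Fin d → ℤ) (x : Fin d → ℝ) : texp (k + l) x = texp k x * texp l x := by
  simp only [texp, ← Complex.exp_add, ← mul_add, ← Finset.sum_add_distrib, Pi.add_apply,
    Int.cast_add, add_mul]

lemma norm_texp (k : Fin d → ℤ) (x : Fin d → ℝ) : ‖texp k x‖ = 1 := by
  have : 2 * Real.pi * Complex.I * (∑ i, (k i : ℂ) * (x i : ℂ))
      = ((2 * Real.pi * ∑ i, (k i : ℝ) * x i : ℝ) : ℂ) * Complex.I := by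
    push_cast; ring
  rw [texp, this, Complex.norm_exp_ofReal_mul_I]

@[fun_prop]
lemma continuous_texp (k : Fin d → ℤ) : Continuous (texp k) := by
  unfold texp; fun_prop

lemma texp_zperiodic (k : Fin d → ℤ) : ZPeriodic (texp k) := by
  intro x i
  have : ∑ j, (k j : ℂ) * (((x + Pi.single i 1 : Fin d → ℝ) j : ℝ) : ℂ)
      = ∑ j, (k j : ℂ) * (x j : ℂ) + k i := by
    simp only [Pi.add_apply, Complex.ofReal_add, mul_add, Finset.sum_add_distrib]
    rw [add_right_inj, Finset.sum_eq_single i]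
    · simp
    · intro j _ hj
      simp [hj]
    · simp
  rw [texp, this, mul_add, Complex.exp_add, mul_comm _ (k i : ℂ),
    Complex.exp_int_mul_two_pi_mul_I, mul_one, texp]

lemma conj_texp (k : Fin d → ℤ) (x : Fin d → ℝ) :
    (starRingEnd ℂ) (texp k x) = texp (-k) x := by
  simp [texp, ← Complex.exp_conj, Complex.conj_ofNat]

lemma tcoeff_eq (u : (Fin d → ℝ) → ℂ) (k : Fin d → ℤ) :
    tcoeff u k = ∫ x in unitCube d, u x * texp (-k) x := by
  simp [tcoeff, texp, unitCube]

lemma tcoeff_texp_mul (u : (Fin d → ℝ) → ℂ) (k l : Fin d → ℤ) :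
    tcoeff (fun x => texp l x * u x) k = tcoeff u (k - l) := by
  simp only [tcoeff_eq]
  congr 1
  ext x
  rw [show -(k - l) = l + -k by abel, texp_add]
  ring

lemma volume_unitCube : (volume : Measure (Fin d → ℝ)) (unitCube d) = 1 := by
  simp [unitCube, volume_pi, Measure.pi_pi]

instance isProbabilityMeasure_restrict_unitCube :
    IsProbabilityMeasure ((volume : Measure (Fin d → ℝ)).restrict (unitCube d)) :=
  ⟨by simp [volume_unitCube]⟩

lemma isCompact_Icc_cube : IsCompact (Set.univ.pi (fun _ : Fin d => Set.Icc (0 : ℝ) 1)) :=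
  isCompact_univ_pi fun _ => isCompact_Icc

lemma unitCube_subset : unitCube d ⊆ Set.univ.pi (fun _ : Fin d => Set.Icc (0 : ℝ) 1) :=
  Set.pi_mono fun _ _ => Ico_subset_Icc_self

lemma measurableSet_unitCube : MeasurableSet (unitCube d) :=
  MeasurableSet.univ_pi fun _ => measurableSet_Ico

lemma Continuous.integrableOn_unitCube {u : (Fin d → ℝ) → ℂ} (hu : Continuous u) :
    IntegrableOn u (unitCube d) :=
  (hu.continuousOn.integrableOn_compact isCompact_Icc_cube).mono_set unitCube_subset

lemma tcoeff_add {u v : (Fin d → ℝ) → ℂ} (hu : Continuous u) (hv : Continuous v)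
    (k : Fin d → ℤ) : tcoeff (u + v) k = tcoeff u k + tcoeff v k := by
  simp only [tcoeff_eq, Pi.add_apply, add_mul]
  exact integral_add (Continuous.integrableOn_unitCube (by fun_prop))
    (Continuous.integrableOn_unitCube (by fun_prop))

lemma tcoeff_smul (c : ℂ) (u : (Fin d → ℝ) → ℂ) (k : Fin d → ℤ) :
    tcoeff (c • u) k = c * tcoeff u k := by
  simp only [tcoeff_eq, Pi.smul_apply, smul_eq_mul, mul_assoc]
  exact integral_const_mul _ _

lemma tcoeff_conj (u : (Fin d → ℝ) → ℂ) (k : Fin d → ℤ) :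
    tcoeff (fun x => (starRingEnd ℂ) (u x)) k = (starRingEnd ℂ) (tcoeff u (-k)) := by
  rw [tcoeff_eq, tcoeff_eq, ← integral_conj]
  simp [conj_texp]

lemma ZPeriodic.add_int {α : Type*} {u : (Fin d → ℝ) → α} (hu : ZPeriodic u) (n : Fin d → ℤ)
    (x : Fin d → ℝ) : u (x + fun i => (n i : ℝ)) = u x := by
  have key : ∀ S : Finset (Fin d), ∀ y,
      u (y + ∑ i ∈ S, n i • (Pi.single i (1 : ℝ) : Fin d → ℝ)) = u y := by
    intro S
    induction S using Finset.induction_on with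
    | empty => simp
    | insert a S ha ih =>
      intro y
      have hp : Function.Periodic u (Pi.single a (1 : ℝ) : Fin d → ℝ) := fun z => hu z a
      rw [Finset.sum_insert ha, ← add_assoc, ih]
      exact hp.zsmul (n a) y
  rw [← key Finset.univ x]
  congr 2
  ext j
  simp [Finset.sum_apply, Pi.single_apply]

/-- A continuous `ℤ^d`-periodic function descends to a continuous function on the torus. -/
lemma ZPeriodic.exists_lift {u : (Fin d → ℝ) → ℂ} (hu : ZPeriodic u) (hc : Continuous u) :
    ∃ U : C(UnitAddTorus (Fin d), ℂ), ∀ x : Fin d → ℝ, U (fun i => (x i : UnitAddCircle)) = u x := by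
  have hq : IsOpenQuotientMap (Pi.map (fun _ : Fin d => fun t : ℝ => (t : UnitAddCircle))) :=
    IsOpenQuotientMap.piMap fun _ => QuotientAddGroup.isOpenQuotientMap_mk
  let π : C(Fin d → ℝ, UnitAddTorus (Fin d)) := ⟨_, hq.continuous⟩
  have hπ : Topology.IsQuotientMap π := hq.isQuotientMap
  have hfac : Function.FactorsThrough u π := by
    intro x y hxy
    have h : ∀ i, ∃ n : ℤ, x i = y i + n := by
      intro i
      have h1 : ((x i : ℝ) : UnitAddCircle) = (y i : ℝ) := congrFun hxy i
      obtain ⟨n, hn⟩ := (QuotientAddGroup.eq_iff_sub_mem.1 h1)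
      exact ⟨n, by simp at hn; linarith⟩
    choose n hn using h
    have : x = y + fun i => (n i : ℝ) := funext hn
    rw [this, hu.add_int]
  refine ⟨hπ.lift ⟨u, hc⟩ hfac, fun x => ?_⟩
  exact congrArg (fun g : C(Fin d → ℝ, ℂ) => g x) (hπ.lift_comp ⟨u, hc⟩ hfac)

lemma mFourier_coe (k : Fin d → ℤ) (x : Fin d → ℝ) :
    UnitAddTorus.mFourier k (fun i => (x i : UnitAddCircle)) = texp k x := by
  simp only [UnitAddTorus.mFourier, ContinuousMap.coe_mk, fourier_coe_apply, texp]
  rw [← Complex.exp_sum, Finset.mul_sum]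
  congr 1
  refine Finset.sum_congr rfl fun i _ => ?_
  push_cast; ring

lemma tcoeff_eq_mFourierCoeff {u : (Fin d → ℝ) → ℂ} {U : C(UnitAddTorus (Fin d), ℂ)}
    (hU : ∀ x : Fin d → ℝ, U (fun i => (x i : UnitAddCircle)) = u x) (k : Fin d → ℤ) :
    tcoeff u k = UnitAddTorus.mFourierCoeff U k := by
  rw [UnitAddTorus.mFourierCoeff_eq_integral U k 0, tcoeff_eq]
  have : (unitCube d : Set (Fin d → ℝ)) =ᵐ[volume]
      {x : Fin d → ℝ | ∀ i, x i ∈ Ioc ((0 : Fin d → ℝ) i) ((0 : Fin d → ℝ) i + 1)} := by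
    have h1 := Measure.univ_pi_Ico_ae_eq_Icc (μ := fun _ : Fin d => (volume : Measure ℝ))
      (f := 0) (g := 1)
    have h2 := Measure.univ_pi_Ioc_ae_eq_Icc (μ := fun _ : Fin d => (volume : Measure ℝ))
      (f := 0) (g := 1)
    have h3 : {x : Fin d → ℝ | ∀ i, x i ∈ Ioc ((0 : Fin d → ℝ) i) ((0 : Fin d → ℝ) i + 1)}
        = Set.univ.pi fun i => Ioc ((0 : Fin d → ℝ) i) ((1 : Fin d → ℝ) i) := by
      ext x; simp
    rw [h3]
    exact h1.trans h2.symm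
  rw [setIntegral_congr_set this]
  congr 1
  ext x
  rw [hU, mFourier_coe, smul_eq_mul, mul_comm]

lemma hasSum_texp {u : (Fin d → ℝ) → ℂ} (hu : ZPeriodic u) (hc : Continuous u)
    (hs : Summable (tcoeff u)) (x : Fin d → ℝ) :
    HasSum (fun k => tcoeff u k * texp k x) (u x) := by
  obtain ⟨U, hU⟩ := hu.exists_lift hc
  have h := tcoeff_eq_mFourierCoeff hU
  have hs' : Summable (UnitAddTorus.mFourierCoeff U) := hs.congr fun k => h k
  have := UnitAddTorus.hasSum_mFourier_series_apply_of_summable hs'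
    (fun i => (x i : UnitAddCircle))
  simpa only [hU, ← h, mFourier_coe, smul_eq_mul] using this

lemma tcoeff_one (k : Fin d → ℤ) : tcoeff (1 : (Fin d → ℝ) → ℂ) k = if k = 0 then 1 else 0 := by
  have hU : ∀ x : Fin d → ℝ,
    (1 : C(UnitAddTorus (Fin d), ℂ)) (fun i => (x i : UnitAddCircle))
      = (1 : (Fin d → ℝ) → ℂ) x := fun x => rfl
  have h := orthonormal_iff_ite.1 (UnitAddTorus.orthonormal_mFourier (d := Fin d)) k 0
  rw [tcoeff_eq_mFourierCoeff hU, ← h, ContinuousMap.inner_toLp, UnitAddTorus.mFourierCoeff]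
  congr 1
  ext t
  simp [UnitAddTorus.mFourier_neg, UnitAddTorus.mFourier_zero]

lemma tcoeff_texp (k l : Fin d → ℤ) : tcoeff (texp l) k = if k = l then 1 else 0 := by
  have := tcoeff_texp_mul (1 : (Fin d → ℝ) → ℂ) k l
  simp only [Pi.one_apply, mul_one] at this
  rw [show texp l = fun x => texp l x from rfl, this, tcoeff_one]
  simp [sub_eq_zero]

/-- Fourier coefficients of a product are the convolution of the Fourier coefficients. -/
lemma hasSum_tcoeff_mul {u v : (Fin d → ℝ) → ℂ} (hu : ZPeriodic u) (hc : Continuous u)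
    (hs : Summable (tcoeff u)) (hv : ZPeriodic v) (hcv : Continuous v) (k : Fin d → ℤ) :
    HasSum (fun l => tcoeff u l * tcoeff v (k - l)) (tcoeff (u * v) k) := by
  obtain ⟨V, hV⟩ := hv.exists_lift hcv
  have hvb : ∀ x, ‖v x‖ ≤ ‖V‖ := fun x => by rw [← hV]; exact V.norm_coe_le_norm _
  have hint : ∀ l, IntegrableOn (fun x => tcoeff u l * texp l x * v x * texp (-k) x)
      (unitCube d) := fun l => Continuous.integrableOn_unitCube (by fun_prop)
  have h := hasSum_integral_of_summable_integral_norm (μ := volume.restrict (unitCube d))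
    (F := fun l x => tcoeff u l * texp l x * v x * texp (-k) x) hint ?_
  · have e1 : ∀ l, ∫ x in unitCube d, tcoeff u l * texp l x * v x * texp (-k) x
        = tcoeff u l * tcoeff v (k - l) := by
      intro l
      rw [← tcoeff_texp_mul, tcoeff_eq (fun x => texp l x * v x), ← integral_const_mul]
      congr 1; ext x; ring
    have e2 : ∫ x in unitCube d, ∑' l, tcoeff u l * texp l x * v x * texp (-k) x
        = tcoeff (u * v) k := by
      rw [tcoeff_eq]
      congr 1; ext x
      rw [Pi.mul_apply]
      exact (((hasSum_texp hu hc hs x).mul_right (v x)).mul_right _).tsum_eq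
    rw [← e2]
    exact h.congr_fun fun l => (e1 l).symm
  · refine Summable.of_nonneg_of_le (fun _ => integral_nonneg fun _ => norm_nonneg _)
      (fun l => ?_) (hs.norm.mul_right ‖V‖)
    calc ∫ x in unitCube d, ‖tcoeff u l * texp l x * v x * texp (-k) x‖
        ≤ ∫ x in unitCube d, ‖tcoeff u l‖ * ‖V‖ := by
          refine integral_mono (hint l).norm (integrable_const _) fun x => ?_
          simp only [norm_mul, norm_texp, mul_one]
          gcongr
          exact hvb x
      _ = ‖tcoeff u l‖ * ‖V‖ := by simp

end Exponentials

section Weights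

variable {d : ℕ} {s : ℝ}

lemma one_le_one_add_sum_sq (k : Fin d → ℤ) : (1 : ℝ) ≤ 1 + ∑ i, (k i : ℝ) ^ 2 := by
  have : 0 ≤ ∑ i, (k i : ℝ) ^ 2 := Finset.sum_nonneg fun _ _ => sq_nonneg _
  linarith

lemma sobWeight_pos (s : ℝ) (k : Fin d → ℤ) : 0 < sobWeight s k :=
  Real.rpow_pos_of_pos (zero_lt_one.trans_le (one_le_one_add_sum_sq k)) _

lemma sobWeight_neg (s : ℝ) (k : Fin d → ℤ) : sobWeight s (-k) = sobWeight s k := by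
  simp [sobWeight]

lemma summable_inv_sobWeight (hs : (d : ℝ) / 2 < s) :
    Summable fun k : Fin d → ℤ => (sobWeight s k)⁻¹ := by
  have hs0 : 0 < s := lt_of_le_of_lt (by positivity) hs
  set b := Pi.basisFun ℝ (Fin d)
  let L : Submodule ℤ (Fin d → ℝ) := Submodule.span ℤ (Set.range b)
  have hrank : Module.finrank ℤ L = d := by
    rw [ZLattice.rank ℝ L]; simp
  have hmem : ∀ k : Fin d → ℤ, (fun i => (k i : ℝ)) ∈ L := by
    intro k
    rw [b.mem_span_iff_repr_mem ℤ]
    intro i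
    exact ⟨k i, by simp [b]⟩
  have h1 : Summable fun z : L => ‖z‖ ^ (-(2 * s)) :=
    ZLattice.summable_norm_rpow L _ (by rw [hrank]; linarith)
  have h2 : Summable fun k : Fin d → ℤ => ‖(fun i => (k i : ℝ))‖ ^ (-(2 * s)) := by
    refine h1.comp_injective (i := fun k : Fin d → ℤ => (⟨_, hmem k⟩ : L)) ?_
    intro k l hkl
    have : (fun i => (k i : ℝ)) = fun i => (l i : ℝ) := congrArg Subtype.val hkl
    ext i
    exact_mod_cast congrFun this i
  refine Summable.of_norm_bounded_eventually h2 ?_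
  filter_upwards [(Set.finite_singleton (0 : Fin d → ℤ)).compl_mem_cofinite] with k hk
  have hk0 : (fun i => (k i : ℝ)) ≠ 0 := by
    intro h
    apply hk
    ext i
    simpa using congrFun h i
  have hn : 0 < ‖(fun i => (k i : ℝ))‖ := norm_pos_iff.2 hk0
  rw [Real.norm_of_nonneg (inv_nonneg.2 (sobWeight_pos s k).le), Real.rpow_neg hn.le]
  apply inv_anti₀ (by positivity)
  rw [mul_comm, mul_comm s, Real.rpow_mul hn.le, sobWeight]
  apply Real.rpow_le_rpow (by positivity) _ hs0.le
  have hS : ‖(fun i => (k i : ℝ))‖ ≤ √(1 + ∑ i, (k i : ℝ) ^ 2) := by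
    refine (pi_norm_le_iff_of_nonneg (by positivity)).2 fun i => ?_
    apply Real.le_sqrt_of_sq_le
    have := Finset.single_le_sum (f := fun i => (k i : ℝ) ^ 2) (fun i _ => sq_nonneg _)
      (Finset.mem_univ i)
    simp only [Real.norm_eq_abs, sq_abs]
    linarith
  calc ‖(fun i => (k i : ℝ))‖ ^ (2 : ℝ) = ‖(fun i => (k i : ℝ))‖ ^ 2 := by norm_cast
    _ ≤ √(1 + ∑ i, (k i : ℝ) ^ 2) ^ 2 := by gcongr
    _ = _ := Real.sq_sqrt (by linarith [one_le_one_add_sum_sq k])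

/-- A quasi-triangle inequality for the Sobolev weights. -/
lemma sobWeight_le_add (hs : 0 ≤ s) (k l : Fin d → ℤ) :
    sobWeight s k ≤ 4 ^ s * (sobWeight s l + sobWeight s (k - l)) := by
  have hsum : 1 + ∑ i, (k i : ℝ) ^ 2 ≤ 4 * max (1 + ∑ i, (l i : ℝ) ^ 2)
      (1 + ∑ i, ((k - l) i : ℝ) ^ 2) := by
    have h1 : ∑ i, (k i : ℝ) ^ 2 ≤ ∑ i, (2 * (l i : ℝ) ^ 2 + 2 * ((k - l) i : ℝ) ^ 2) := by
      apply Finset.sum_le_sum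
      intro i _
      push_cast [Pi.sub_apply]
      nlinarith [sq_nonneg ((l i : ℝ) - (k i - l i))]
    rw [Finset.sum_add_distrib, ← Finset.mul_sum, ← Finset.mul_sum] at h1
    have h2 := le_max_left (1 + ∑ i, (l i : ℝ) ^ 2) (1 + ∑ i, ((k - l) i : ℝ) ^ 2)
    have h3 := le_max_right (1 + ∑ i, (l i : ℝ) ^ 2) (1 + ∑ i, ((k - l) i : ℝ) ^ 2)
    linarith
  have hl := sobWeight_pos s l
  have hkl := sobWeight_pos s (k - l)
  calc sobWeight s k ≤ (4 * max (1 + ∑ i, (l i : ℝ) ^ 2) (1 + ∑ i, ((k - l) i : ℝ) ^ 2)) ^ s :=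
        Real.rpow_le_rpow (by linarith [one_le_one_add_sum_sq k]) hsum hs
    _ = 4 ^ s * (max (1 + ∑ i, (l i : ℝ) ^ 2) (1 + ∑ i, ((k - l) i : ℝ) ^ 2)) ^ s :=
        Real.mul_rpow (by norm_num) (le_max_of_le_left (by linarith [one_le_one_add_sum_sq l]))
    _ ≤ 4 ^ s * (sobWeight s l + sobWeight s (k - l)) := by
        gcongr
        rcases max_cases (1 + ∑ i, (l i : ℝ) ^ 2) (1 + ∑ i, ((k - l) i : ℝ) ^ 2) with h | h <;>
          rw [h.1] <;> change sobWeight s _ ≤ _ <;> linarith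

/-- Summability of a weighted square-summable family, with an explicit bound. -/
lemma summable_and_sq_tsum_le {ι : Type*} {w a : ι → ℝ} (hw : ∀ i, 0 < w i) (ha : ∀ i, 0 ≤ a i)
    (h1 : Summable fun i => (w i)⁻¹) (h2 : Summable fun i => w i * a i ^ 2) :
    Summable a ∧ (∑' i, a i) ^ 2 ≤ (∑' i, (w i)⁻¹) * ∑' i, w i * a i ^ 2 := by
  have e1 : ∀ i, √((w i)⁻¹) ^ (2 : ℝ) = (w i)⁻¹ := fun i => by
    rw [Real.rpow_two, Real.sq_sqrt (inv_nonneg.2 (hw i).le)]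
  have e2 : ∀ i, (√(w i) * a i) ^ (2 : ℝ) = w i * a i ^ 2 := fun i => by
    rw [Real.rpow_two, mul_pow, Real.sq_sqrt (hw i).le]
  have e3 : ∀ i, √((w i)⁻¹) * (√(w i) * a i) = a i := fun i => by
    rw [← mul_assoc, ← Real.sqrt_mul (inv_nonneg.2 (hw i).le), inv_mul_cancel₀ (hw i).ne',
      Real.sqrt_one, one_mul]
  have := Real.summable_and_inner_le_Lp_mul_Lq_tsum_of_nonneg (p := 2) (q := 2)
    (f := fun i => √((w i)⁻¹)) (g := fun i => √(w i) * a i) Real.HolderConjugate.two_two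
    (fun i => Real.sqrt_nonneg _) (fun i => mul_nonneg (Real.sqrt_nonneg _) (ha i))
    (by simpa only [e1] using h1) (by simpa only [e2] using h2)
  simp only [e1, e2, e3] at this
  refine ⟨this.1, ?_⟩
  have hA : 0 ≤ ∑' i, (w i)⁻¹ := tsum_nonneg fun i => inv_nonneg.2 (hw i).le
  have hB : 0 ≤ ∑' i, w i * a i ^ 2 := tsum_nonneg fun i => by have := hw i; positivity
  calc (∑' i, a i) ^ 2
      ≤ ((∑' i, (w i)⁻¹) ^ (1 / 2 : ℝ) * (∑' i, w i * a i ^ 2) ^ (1 / 2 : ℝ)) ^ 2 := by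
        gcongr
        exacts [tsum_nonneg ha, this.2]
    _ = _ := by
        rw [← Real.sqrt_eq_rpow, ← Real.sqrt_eq_rpow, mul_pow, Real.sq_sqrt hA, Real.sq_sqrt hB]

/-- Young-type inequality making the weighted `ℓ²` space a convolution algebra. -/
lemma summable_weighted_convolution (hs : (d : ℝ) / 2 < s) {a b : (Fin d → ℤ) → ℝ}
    (ha : ∀ k, 0 ≤ a k) (hb : ∀ k, 0 ≤ b k)
    (hsa : Summable fun k => sobWeight s k * a k ^ 2)
    (hsb : Summable fun k => sobWeight s k * b k ^ 2) :
    Summable (fun k => sobWeight s k * (∑' l, a l * b (k - l)) ^ 2) ∧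
    ∑' k, sobWeight s k * (∑' l, a l * b (k - l)) ^ 2 ≤
      (2 * 4 ^ s * ∑' k : Fin d → ℤ, (sobWeight s k)⁻¹) *
        ((∑' k, sobWeight s k * a k ^ 2) * ∑' k, sobWeight s k * b k ^ 2) := by
  have hs0 : 0 ≤ s := le_trans (by positivity) hs.le
  have hW := summable_inv_sobWeight hs
  set M : ℝ := 2 * 4 ^ s * ∑' k : Fin d → ℤ, (sobWeight s k)⁻¹
  have hw := sobWeight_pos (d := d) s
  let P : (Fin d → ℤ) × (Fin d → ℤ) → ℝ := fun p =>
    (sobWeight s p.2 * a p.2 ^ 2) * (sobWeight s (p.1 - p.2) * b (p.1 - p.2) ^ 2)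
  let e : (Fin d → ℤ) × (Fin d → ℤ) ≃ (Fin d → ℤ) × (Fin d → ℤ) :=
    { toFun := fun p => (p.2, p.1 - p.2)
      invFun := fun q => (q.1 + q.2, q.1)
      left_inv := fun p => by simp
      right_inv := fun q => by simp }
  have hprod : Summable fun q : (Fin d → ℤ) × (Fin d → ℤ) =>
      (sobWeight s q.1 * a q.1 ^ 2) * (sobWeight s q.2 * b q.2 ^ 2) :=
    hsa.mul_of_nonneg hsb (fun k => by have := hw k; positivity)
      (fun k => by have := hw k; positivity)
  have hP : Summable P := e.summable_iff.2 hprod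
  have hPt : ∑' p, P p = (∑' k, sobWeight s k * a k ^ 2) * ∑' k, sobWeight s k * b k ^ 2 := by
    rw [hsa.tsum_mul_tsum hsb hprod]
    exact e.tsum_eq (fun q : (Fin d → ℤ) × (Fin d → ℤ) =>
      (sobWeight s q.1 * a q.1 ^ 2) * (sobWeight s q.2 * b q.2 ^ 2))
  have hPk : ∀ k, Summable fun l => P (k, l) := fun k => hP.prod_factor k
  have hbound : ∀ k, sobWeight s k * (∑' l, a l * b (k - l)) ^ 2 ≤ M * ∑' l, P (k, l) := by
    intro k
    have hinv : ∀ l, sobWeight s k * (sobWeight s l * sobWeight s (k - l))⁻¹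
        ≤ 4 ^ s * ((sobWeight s l)⁻¹ + (sobWeight s (k - l))⁻¹) := by
      intro l
      have := sobWeight_le_add hs0 k l
      have h1 := hw l
      have h2 := hw (k - l)
      calc sobWeight s k * (sobWeight s l * sobWeight s (k - l))⁻¹
          ≤ (4 ^ s * (sobWeight s l + sobWeight s (k - l))) *
            (sobWeight s l * sobWeight s (k - l))⁻¹ := by gcongr
        _ = _ := by field_simp; ring
    have hWk : Summable fun l => (sobWeight s (k - l))⁻¹ :=
      (Equiv.subLeft k).summable_iff (f := fun l => (sobWeight s l)⁻¹) |>.2 hW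
    have hWk' : ∑' l, (sobWeight s (k - l))⁻¹ = ∑' l, (sobWeight s l)⁻¹ :=
      (Equiv.subLeft k).tsum_eq fun l => (sobWeight s l)⁻¹
    have hR : Summable fun l => 4 ^ s * ((sobWeight s l)⁻¹ + (sobWeight s (k - l))⁻¹) :=
      (hW.add hWk).mul_left _
    have hL : Summable fun l => sobWeight s k * (sobWeight s l * sobWeight s (k - l))⁻¹ :=
      Summable.of_nonneg_of_le (fun l => by have := hw k; have := hw l; have := hw (k - l); positivity)
        hinv hR
    have hL' : Summable fun l => (sobWeight s l * sobWeight s (k - l))⁻¹ :=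
      (summable_mul_left_iff (hw k).ne').1 hL
    have hcs := (summable_and_sq_tsum_le (w := fun l => sobWeight s l * sobWeight s (k - l))
      (a := fun l => a l * b (k - l)) (fun l => mul_pos (hw l) (hw _))
      (fun l => mul_nonneg (ha l) (hb _)) hL' ((hPk k).congr fun l => by simp only [P]; ring)).2
    have hPe : ∑' l, sobWeight s l * sobWeight s (k - l) * (a l * b (k - l)) ^ 2
        = ∑' l, P (k, l) := tsum_congr fun l => by simp only [P]; ring
    rw [hPe] at hcs
    calc sobWeight s k * (∑' l, a l * b (k - l)) ^ 2
        ≤ sobWeight s k * ((∑' l, (sobWeight s l * sobWeight s (k - l))⁻¹) * ∑' l, P (k, l)) := by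
          have := hw k; gcongr
      _ = (∑' l, sobWeight s k * (sobWeight s l * sobWeight s (k - l))⁻¹) * ∑' l, P (k, l) := by
          rw [tsum_mul_left]; ring
      _ ≤ (∑' l, 4 ^ s * ((sobWeight s l)⁻¹ + (sobWeight s (k - l))⁻¹)) * ∑' l, P (k, l) := by
          refine mul_le_mul_of_nonneg_right (hL.tsum_le_tsum hinv hR) (tsum_nonneg fun l => ?_)
          have := hw l; have := hw (k - l); simp only [P]; positivity
      _ = M * ∑' l, P (k, l) := by
          rw [tsum_mul_left, hW.tsum_add hWk, hWk']; simp only [M]; ring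
  have hsum : Summable fun k => M * ∑' l, P (k, l) := hP.prod.mul_left M
  have hS : Summable (fun k => sobWeight s k * (∑' l, a l * b (k - l)) ^ 2) :=
    Summable.of_nonneg_of_le (fun k => by have := hw k; positivity) hbound hsum
  refine ⟨hS, (hS.tsum_le_tsum hbound hsum).trans_eq ?_⟩
  rw [tsum_mul_left, ← hP.tsum_prod, hPt]

end Weights

section SobolevSpace

variable {d : ℕ} {s : ℝ} {u v : (Fin d → ℝ) → ℂ}

lemma sobNormSq_nonneg (s : ℝ) (u : (Fin d → ℝ) → ℂ) : 0 ≤ sobNormSq s u :=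
  tsum_nonneg fun k => by have := sobWeight_pos s k; positivity

lemma sobNorm_nonneg (s : ℝ) (u : (Fin d → ℝ) → ℂ) : 0 ≤ sobNorm s u := Real.sqrt_nonneg _

/-- The constant `∑ₖ (1 + |k|²)^{-s}`. -/
noncomputable def invWeightSum (d : ℕ) (s : ℝ) : ℝ := ∑' k : Fin d → ℤ, (sobWeight s k)⁻¹

lemma invWeightSum_nonneg : 0 ≤ invWeightSum d s :=
  tsum_nonneg fun k => inv_nonneg.2 (sobWeight_pos s k).le

lemma MemHs.summable_norm_tcoeff (hs : (d : ℝ) / 2 < s) (hu : MemHs s u) :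
    Summable fun k => ‖tcoeff u k‖ :=
  (summable_and_sq_tsum_le (sobWeight_pos s) (fun _ => norm_nonneg _)
    (summable_inv_sobWeight hs) hu.2).1

/-- The Sobolev embedding into bounded functions. -/
lemma MemHs.norm_apply_le (hs : (d : ℝ) / 2 < s) (hu : MemHs s u) (hc : Continuous u)
    (x : Fin d → ℝ) : ‖u x‖ ≤ √(invWeightSum d s) * sobNorm s u := by
  have h1 := hu.summable_norm_tcoeff hs
  have h2 := (summable_and_sq_tsum_le (sobWeight_pos s) (fun k => norm_nonneg (tcoeff u k))
    (summable_inv_sobWeight hs) hu.2).2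
  have h3 := (hasSum_texp hu.1 hc h1.of_norm x).tsum_eq
  have h4 : ‖u x‖ ≤ ∑' k, ‖tcoeff u k‖ := by
    rw [← h3]
    refine (norm_tsum_le_tsum_norm ?_).trans_eq ?_ <;> simp [norm_texp, h1]
  refine h4.trans ?_
  rw [sobNorm, ← Real.sqrt_mul invWeightSum_nonneg]
  exact Real.le_sqrt_of_sq_le h2

lemma memHs_texp (s : ℝ) (k : Fin d → ℤ) : MemHs s (texp k) := by
  refine ⟨texp_zperiodic k, summable_of_hasFiniteSupport ?_⟩
  refine (Set.finite_singleton k).subset fun l hl => ?_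
  by_contra h
  apply hl
  simp only [Set.mem_singleton_iff] at h
  simp [tcoeff_texp, h]

lemma sobNorm_texp (s : ℝ) (k : Fin d → ℤ) : sobNorm s (texp k) = √(sobWeight s k) := by
  rw [sobNorm, sobNormSq, tsum_eq_single k]
  · simp [tcoeff_texp]
  · intro l hl
    simp [tcoeff_texp, hl]

lemma MemHs.add (hu : MemHs s u) (hv : MemHs s v) (hcu : Continuous u) (hcv : Continuous v) :
    MemHs s (u + v) := by
  refine ⟨fun x i => by simp [hu.1 x i, hv.1 x i], ?_⟩
  refine Summable.of_nonneg_of_le (fun k => ?_) (fun k => ?_) ((hu.2.add hv.2).mul_left 2)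
  · have := sobWeight_pos s k; positivity
  · have hw := sobWeight_pos s k
    rw [tcoeff_add hcu hcv]
    have h := norm_add_le (tcoeff u k) (tcoeff v k)
    have h2 : ‖tcoeff u k + tcoeff v k‖ ^ 2 ≤ 2 * (‖tcoeff u k‖ ^ 2 + ‖tcoeff v k‖ ^ 2) := by
      nlinarith [norm_nonneg (tcoeff u k + tcoeff v k), sq_nonneg (‖tcoeff u k‖ - ‖tcoeff v k‖)]
    nlinarith

lemma MemHs.smul (c : ℂ) (hu : MemHs s u) : MemHs s (c • u) := by
  refine ⟨fun x i => by simp [hu.1 x i], ?_⟩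
  refine (hu.2.mul_left (‖c‖ ^ 2)).congr fun k => ?_
  rw [tcoeff_smul, norm_mul]
  ring

lemma MemHs.conj (hu : MemHs s u) : MemHs s fun x => (starRingEnd ℂ) (u x) := by
  refine ⟨fun x i => by simp only [hu.1 x i], ?_⟩
  refine ((Equiv.neg (Fin d → ℤ)).summable_iff.2 hu.2).congr fun k => ?_
  simp [tcoeff_conj, sobWeight_neg]

lemma MemHs.mul_aux (hs : (d : ℝ) / 2 < s) (hu : MemHs s u) (hv : MemHs s v)
    (hcu : Continuous u) (hcv : Continuous v) :
    MemHs s (u * v) ∧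
      sobNormSq s (u * v) ≤ 2 * 4 ^ s * invWeightSum d s * (sobNormSq s u * sobNormSq s v) := by
  have hau := hu.summable_norm_tcoeff hs
  have hav := hv.summable_norm_tcoeff hs
  obtain ⟨h1, h2⟩ := summable_weighted_convolution hs (fun k => norm_nonneg (tcoeff u k))
    (fun k => norm_nonneg (tcoeff v k)) hu.2 hv.2
  have hle : ∀ k, sobWeight s k * ‖tcoeff (u * v) k‖ ^ 2 ≤
      sobWeight s k * (∑' l, ‖tcoeff u l‖ * ‖tcoeff v (k - l)‖) ^ 2 := by
    intro k
    have hw := sobWeight_pos s k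
    have hsum : Summable fun l => ‖tcoeff u l * tcoeff v (k - l)‖ := by
      refine Summable.of_nonneg_of_le (fun _ => norm_nonneg _) (fun l => ?_)
        (hau.mul_right (∑' m, ‖tcoeff v m‖))
      rw [norm_mul]
      gcongr
      exact hav.le_tsum (k - l) fun _ _ => norm_nonneg _
    gcongr
    rw [← (hasSum_tcoeff_mul hu.1 hcu hau.of_norm hv.1 hcv k).tsum_eq]
    refine (norm_tsum_le_tsum_norm hsum).trans_eq ?_
    simp
  have hS : Summable fun k => sobWeight s k * ‖tcoeff (u * v) k‖ ^ 2 :=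
    Summable.of_nonneg_of_le (fun k => by have := sobWeight_pos s k; positivity) hle h1
  exact ⟨⟨fun x i => by simp [hu.1 x i, hv.1 x i], hS⟩, (hS.tsum_le_tsum hle h1).trans h2⟩

/-- The algebra of continuous `H^s` functions on the torus, for `s > d/2`. -/
def sobSubalgebra (hs : (d : ℝ) / 2 < s) : Subalgebra ℂ ((Fin d → ℝ) → ℂ) where
  carrier := {u | MemHs s u ∧ Continuous u}
  mul_mem' hu hv := ⟨(hu.1.mul_aux hs hv.1 hu.2 hv.2).1, hu.2.mul hv.2⟩
  add_mem' hu hv := ⟨hu.1.add hv.1 hu.2 hv.2, hu.2.add hv.2⟩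
  algebraMap_mem' c := by
    have h : algebraMap ℂ ((Fin d → ℝ) → ℂ) c = c • texp 0 := by
      rw [texp_zero, Algebra.algebraMap_eq_smul_one]
    rw [h]
    exact ⟨(memHs_texp s 0).smul c, (continuous_texp 0).const_smul c⟩

/-- The Banach algebra `H^s(𝕋^d; ℂ)`, `s > d/2`, carrying a multiple of the Sobolev norm. -/
def SobAlg (hs : (d : ℝ) / 2 < s) : Type := sobSubalgebra hs

namespace SobAlg

variable {hs : (d : ℝ) / 2 < s}

instance : CommRing (SobAlg hs) := inferInstanceAs (CommRing (sobSubalgebra hs))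
instance : Algebra ℂ (SobAlg hs) := inferInstanceAs (Algebra ℂ (sobSubalgebra hs))

/-- Point evaluation. -/
def eval (hs : (d : ℝ) / 2 < s) (x : Fin d → ℝ) : SobAlg hs →ₐ[ℂ] ℂ :=
  (Pi.evalAlgHom ℂ (fun _ : Fin d → ℝ => ℂ) x).comp (sobSubalgebra hs).val

instance : FunLike (SobAlg hs) (Fin d → ℝ) ℂ where
  coe a := a.1
  coe_injective _ _ h := Subtype.ext h

/-- The element of `SobAlg` given by a continuous `H^s` function. -/
def mk (hs : (d : ℝ) / 2 < s) (u : (Fin d → ℝ) → ℂ) (hu : MemHs s u) (hc : Continuous u) :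
    SobAlg hs := ⟨u, hu, hc⟩

lemma coe_mk (hu : MemHs s u) (hc : Continuous u) : ⇑(mk hs u hu hc) = u := rfl

@[ext] lemma ext {a b : SobAlg hs} (h : ∀ x, a x = b x) : a = b := DFunLike.ext _ _ h

lemma memHs (a : SobAlg hs) : MemHs s a := a.2.1
lemma continuous (a : SobAlg hs) : Continuous a := a.2.2

lemma coe_add (a b : SobAlg hs) : ⇑(a + b) = a + b := rfl
lemma coe_smul (c : ℂ) (a : SobAlg hs) : ⇑(c • a) = c • ⇑a := rfl
lemma coe_mul (a b : SobAlg hs) : ⇑(a * b) = ⇑a * ⇑b := rfl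

/-- The Fourier coefficient as a linear functional. -/
noncomputable def coeff (hs : (d : ℝ) / 2 < s) (k : Fin d → ℤ) : SobAlg hs →ₗ[ℂ] ℂ where
  toFun a := tcoeff a k
  map_add' a b := by rw [coe_add, tcoeff_add a.continuous b.continuous]
  map_smul' c a := by rw [coe_smul, tcoeff_smul]; rfl

lemma coeff_apply (a : SobAlg hs) (k : Fin d → ℤ) : coeff hs k a = tcoeff a k := rfl

lemma eq_zero_of_coeff {a : SobAlg hs} (h : ∀ k, coeff hs k a = 0) : a = 0 := by
  ext x
  have := hasSum_texp a.memHs.1 a.continuous (a.memHs.summable_norm_tcoeff hs).of_norm x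
  simp only [← coeff_apply, h, zero_mul] at this
  rw [this.unique hasSum_zero]
  rfl

lemma summable_coeff (a : SobAlg hs) :
    Summable fun k => sobWeight s k * ‖coeff hs k a‖ ^ 2 := a.memHs.2

lemma sobNormSq_eq (a : SobAlg hs) :
    sobNormSq s a = ∑' k, sobWeight s k * ‖coeff hs k a‖ ^ 2 := rfl

/-- The weighted Fourier coefficients, as a linear map into `ℓ²`. -/
noncomputable def toLp (hs : (d : ℝ) / 2 < s) :
    SobAlg hs →ₗ[ℂ] lp (fun _ : Fin d → ℤ => ℂ) 2 where
  toFun a := ⟨fun k => (√(sobWeight s k) : ℂ) * coeff hs k a, by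
    refine (memℓp_gen_iff (by norm_num)).2 (a.summable_coeff.congr fun k => ?_)
    simp [mul_pow, Real.sq_sqrt (sobWeight_pos s k).le]⟩
  map_add' a b := by ext k; simp [mul_add]; rfl
  map_smul' c a := by
    ext k
    simp only [map_smul, smul_eq_mul, mul_left_comm]
    rfl

lemma norm_toLp (a : SobAlg hs) : ‖toLp hs a‖ = sobNorm s a := by
  rw [lp.norm_eq_tsum_rpow (by norm_num), sobNorm, Real.sqrt_eq_rpow, sobNormSq_eq]
  congr 1
  refine tsum_congr fun k => ?_
  simp [toLp, mul_pow, Real.sq_sqrt (sobWeight_pos s k).le]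

/-- The factor by which the norm of `SobAlg` exceeds the Sobolev norm. -/
noncomputable def scale (d : ℕ) (s : ℝ) : ℝ := √(2 * 4 ^ s * invWeightSum d s) + 1

lemma scale_pos (d : ℕ) (s : ℝ) : 0 < scale d s := by unfold scale; positivity

lemma sobNorm_mul_le (a b : SobAlg hs) :
    sobNorm s ⇑(a * b) ≤ scale d s * sobNorm s a * sobNorm s b := by
  have h := (a.memHs.mul_aux hs b.memHs a.continuous b.continuous).2
  have hM : 0 ≤ 2 * 4 ^ s * invWeightSum d s := mul_nonneg (by positivity) invWeightSum_nonneg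
  have h1 : sobNorm s ⇑(a * b) ≤ √(2 * 4 ^ s * invWeightSum d s) * (sobNorm s a * sobNorm s b) := by
    rw [coe_mul, sobNorm, sobNorm, sobNorm, ← Real.sqrt_mul (sobNormSq_nonneg _ _),
      ← Real.sqrt_mul hM]
    exact Real.sqrt_le_sqrt h
  have h2 : 0 ≤ sobNorm s a * sobNorm s b := mul_nonneg (sobNorm_nonneg _ _) (sobNorm_nonneg _ _)
  unfold scale
  linarith

/-- The linear map inducing the norm of `SobAlg`. -/
noncomputable def scaledToLp (hs : (d : ℝ) / 2 < s) :
    SobAlg hs →ₗ[ℂ] lp (fun _ : Fin d → ℤ => ℂ) 2 := (scale d s : ℂ) • toLp hs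

lemma norm_scaledToLp (a : SobAlg hs) : ‖scaledToLp hs a‖ = scale d s * sobNorm s a := by
  rw [scaledToLp, LinearMap.smul_apply, norm_smul, norm_toLp]
  simp [abs_of_pos (scale_pos d s)]

lemma scaledToLp_injective : Function.Injective (scaledToLp hs) := by
  rw [← LinearMap.ker_eq_bot, LinearMap.ker_eq_bot']
  intro a ha
  have h : toLp hs a = 0 := by
    have : (scale d s : ℂ) ≠ 0 := by exact_mod_cast (scale_pos d s).ne'
    exact (smul_eq_zero.1 (show (scale d s : ℂ) • toLp hs a = 0 from ha)).resolve_left this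
  refine eq_zero_of_coeff fun k => ?_
  have h2 : (√(sobWeight s k) : ℂ) * coeff hs k a = 0 :=
    congrFun (congrArg (fun f : lp (fun _ : Fin d → ℤ => ℂ) 2 => (f : (Fin d → ℤ) → ℂ)) h) k
  have h3 : (√(sobWeight s k) : ℂ) ≠ 0 := by
    exact_mod_cast (Real.sqrt_pos.2 (sobWeight_pos s k)).ne'
  simpa [h3] using h2

noncomputable instance : NormedCommRing (SobAlg hs) :=
  { NormedAddCommGroup.induced (SobAlg hs) _ (scaledToLp hs) scaledToLp_injective,
    (inferInstance : CommRing (SobAlg hs)) with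
    norm_mul_le := fun a b => by
      change ‖scaledToLp hs (a * b)‖ ≤ ‖scaledToLp hs a‖ * ‖scaledToLp hs b‖
      simp only [norm_scaledToLp]
      have := mul_le_mul_of_nonneg_left (sobNorm_mul_le a b) (scale_pos d s).le
      linarith }

lemma norm_eq (a : SobAlg hs) : ‖a‖ = scale d s * sobNorm s a := norm_scaledToLp a

noncomputable instance : NormedAlgebra ℂ (SobAlg hs) where
  norm_smul_le c a := by
    change ‖scaledToLp hs (c • a)‖ ≤ ‖c‖ * ‖scaledToLp hs a‖
    rw [map_smul, norm_smul]

end SobAlg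

end SobolevSpace

namespace SobAlg

variable {d : ℕ} {s : ℝ} {hs : (d : ℝ) / 2 < s}

lemma norm_apply_le (a : SobAlg hs) (x : Fin d → ℝ) :
    ‖a x‖ ≤ √(invWeightSum d s) / scale d s * ‖a‖ := by
  have := a.memHs.norm_apply_le hs a.continuous x
  rw [norm_eq, ← mul_assoc, div_mul_cancel₀ _ (scale_pos d s).ne']
  exact this

/-- Point evaluation as a continuous linear functional. -/
noncomputable def evalCLM (hs : (d : ℝ) / 2 < s) (x : Fin d → ℝ) : SobAlg hs →L[ℂ] ℂ :=
  (eval hs x).toLinearMap.mkContinuous (√(invWeightSum d s) / scale d s) fun a => norm_apply_le a x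

lemma evalCLM_apply (x : Fin d → ℝ) (a : SobAlg hs) : evalCLM hs x a = a x := rfl

/-- The exponential monomials as elements of `SobAlg`. -/
noncomputable def expo (hs : (d : ℝ) / 2 < s) (k : Fin d → ℤ) : SobAlg hs :=
  mk hs (texp k) (memHs_texp s k) (continuous_texp k)

lemma expo_apply (k : Fin d → ℤ) (x : Fin d → ℝ) : expo hs k x = texp k x := rfl

lemma expo_zero : expo hs 0 = 1 := by
  ext x
  rw [expo_apply, texp_zero]
  rfl

lemma expo_add (k l : Fin d → ℤ) : expo hs (k + l) = expo hs k * expo hs l := by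
  ext x
  exact texp_add k l x

lemma norm_expo (k : Fin d → ℤ) : ‖expo hs k‖ = scale d s * √(sobWeight s k) := by
  rw [norm_eq, expo, coe_mk, sobNorm_texp]

/-- The partial sums of the Fourier series. -/
noncomputable def trunc (S : Finset (Fin d → ℤ)) (a : SobAlg hs) : SobAlg hs :=
  ∑ k ∈ S, coeff hs k a • expo hs k

lemma coeff_expo (k l : Fin d → ℤ) : coeff hs k (expo hs l) = if k = l then 1 else 0 :=
  tcoeff_texp k l

lemma coeff_trunc (S : Finset (Fin d → ℤ)) (a : SobAlg hs) (k : Fin d → ℤ) :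
    coeff hs k (trunc S a) = if k ∈ S then coeff hs k a else 0 := by
  simp [trunc, coeff_expo]

lemma norm_le_of_sobNormSq_le {a b : SobAlg hs} (h : sobNormSq s a ≤ sobNormSq s b) :
    ‖a‖ ≤ ‖b‖ := by
  rw [norm_eq, norm_eq]
  have := scale_pos d s
  have := Real.sqrt_le_sqrt h
  unfold sobNorm
  gcongr

lemma norm_trunc_le (S : Finset (Fin d → ℤ)) (a : SobAlg hs) : ‖trunc S a‖ ≤ ‖a‖ := by
  apply norm_le_of_sobNormSq_le
  rw [sobNormSq_eq, sobNormSq_eq]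
  refine (trunc S a).summable_coeff.tsum_le_tsum (fun k => ?_) a.summable_coeff
  have := sobWeight_pos s k
  rw [coeff_trunc]
  split_ifs
  · exact le_rfl
  · simp only [norm_zero, ne_eq, OfNat.ofNat_ne_zero, not_false_eq_true, zero_pow, mul_zero]
    positivity

lemma trunc_sub (S : Finset (Fin d → ℤ)) (a b : SobAlg hs) :
    trunc S (a - b) = trunc S a - trunc S b := by
  simp [trunc, sub_smul]

lemma tendsto_trunc (a : SobAlg hs) :
    Tendsto (fun S => trunc S a) atTop (𝓝 a) := by
  rw [tendsto_iff_norm_sub_tendsto_zero]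
  have h0 := tendsto_tsum_compl_atTop_zero fun k => sobWeight s k * ‖coeff hs k a‖ ^ 2
  have h1 : ∀ S : Finset (Fin d → ℤ), ‖trunc S a - a‖ =
      scale d s * √(∑' k : {k : Fin d → ℤ // k ∉ S}, sobWeight s k.1 * ‖coeff hs k.1 a‖ ^ 2) := by
    intro S
    rw [norm_eq, sobNorm, sobNormSq_eq]
    congr 2
    have := tsum_subtype ({k | k ∉ S} : Set (Fin d → ℤ))
      fun k => sobWeight s k * ‖coeff hs k a‖ ^ 2
    refine Eq.trans (tsum_congr fun k => ?_) this.symm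
    by_cases hk : k ∈ S <;> simp [coeff_trunc, hk]
  simp only [h1]
  have h2 := (Real.continuous_sqrt.tendsto 0).comp h0
  simpa using h2.const_mul (scale d s)

/-- Multiplicative characters bounded by the norms of the monomials have modulus at most one. -/
lemma norm_le_one_of_polynomial_growth {χ : (Fin d → ℤ) → ℂ} (hχ0 : χ 0 = 1)
    (hχ : ∀ k l, χ (k + l) = χ k * χ l) {C : ℝ} (hs0 : 0 ≤ s)
    (hC : ∀ k, ‖χ k‖ ≤ C * √(sobWeight s k)) (k : Fin d → ℤ) : ‖χ k‖ ≤ 1 := by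
  by_contra! hk
  have hpow : ∀ n : ℕ, χ (n • k) = χ k ^ n := by
    intro n
    induction n with
    | zero => simp [hχ0]
    | succ n ih => rw [succ_nsmul, hχ, ih, pow_succ]
  have hC0 : 0 ≤ C := by
    have h := (norm_nonneg _).trans (hC 0)
    have := Real.sqrt_pos.2 (sobWeight_pos s (0 : Fin d → ℤ))
    exact nonneg_of_mul_nonneg_left h this
  set m := ⌈s⌉₊
  have hw : ∀ n : ℕ, 1 ≤ n → √(sobWeight s (n • k)) ≤ √(sobWeight s k) * (n : ℝ) ^ m := by
    intro n hn
    have hn1 : (1 : ℝ) ≤ n := by exact_mod_cast hn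
    rw [← Real.sqrt_sq (show 0 ≤ (n : ℝ) ^ m by positivity),
      ← Real.sqrt_mul (sobWeight_pos s k).le]
    apply Real.sqrt_le_sqrt
    have h1 : 1 + ∑ i, ((n • k) i : ℝ) ^ 2 ≤ (1 + ∑ i, (k i : ℝ) ^ 2) * (n : ℝ) ^ 2 := by
      have e : ∑ i, ((n • k) i : ℝ) ^ 2 = (∑ i, (k i : ℝ) ^ 2) * (n : ℝ) ^ 2 := by
        rw [Finset.sum_mul]
        refine Finset.sum_congr rfl fun i _ => ?_
        simp; ring
      rw [e]
      nlinarith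
    calc sobWeight s (n • k) ≤ ((1 + ∑ i, (k i : ℝ) ^ 2) * (n : ℝ) ^ 2) ^ s :=
          Real.rpow_le_rpow (by linarith [one_le_one_add_sum_sq (n • k)]) h1 hs0
      _ = sobWeight s k * ((n : ℝ) ^ 2) ^ s :=
          Real.mul_rpow (by linarith [one_le_one_add_sum_sq k]) (by positivity)
      _ ≤ sobWeight s k * ((n : ℝ) ^ 2) ^ (m : ℝ) := by
          have := sobWeight_pos s k
          gcongr
          · nlinarith
          · exact Nat.le_ceil s
      _ = _ := by rw [Real.rpow_natCast, ← pow_mul, ← pow_mul, mul_comm 2 m]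
  have hlim := tendsto_pow_const_div_const_pow_of_one_lt m hk
  have hlim2 := hlim.const_mul (C * √(sobWeight s k))
  rw [mul_zero] at hlim2
  obtain ⟨n, hn, hn1⟩ := ((hlim2.eventually (gt_mem_nhds one_pos)).and
    (eventually_ge_atTop 1)).exists
  have hp : 0 < ‖χ k‖ ^ n := by positivity
  have h3 : ‖χ k‖ ^ n ≤ C * (√(sobWeight s k) * (n : ℝ) ^ m) := by
    rw [← norm_pow, ← hpow]
    exact (hC _).trans (by gcongr; exact hw n hn1)
  rw [← mul_div_assoc, div_lt_one hp] at hn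
  linarith

/-- A bounded character of `ℤ^d` is evaluation of the exponentials at a point. -/
lemma exists_eq_texp {χ : (Fin d → ℤ) → ℂ} (hχ0 : χ 0 = 1)
    (hχ : ∀ k l, χ (k + l) = χ k * χ l) (hle : ∀ k, ‖χ k‖ ≤ 1) :
    ∃ x : Fin d → ℝ, ∀ k, χ k = texp k x := by
  have hnorm : ∀ k, ‖χ k‖ = 1 := by
    intro k
    have h : ‖χ k‖ * ‖χ (-k)‖ = 1 := by rw [← norm_mul, ← hχ, add_neg_cancel, hχ0, norm_one]
    refine le_antisymm (hle k) ?_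
    nlinarith [hle k, hle (-k), norm_nonneg (χ k), norm_nonneg (χ (-k))]
  let x : Fin d → ℝ := fun i => (χ (Pi.single i 1)).arg / (2 * Real.pi)
  refine ⟨x, fun k => ?_⟩
  let f : (Fin d → ℤ) →+ Additive ℂ :=
    { toFun := fun k => Additive.ofMul (χ k)
      map_zero' := by rw [hχ0]; rfl
      map_add' := fun k l => by rw [hχ]; rfl }
  let g : (Fin d → ℤ) →+ Additive ℂ :=
    { toFun := fun k => Additive.ofMul (texp k x)
      map_zero' := by rw [texp_zero]; rfl
      map_add' := fun k l => by rw [texp_add]; rfl }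
  have hfg : f = g := by
    refine AddMonoidHom.functions_ext' _ _ _ fun i => AddMonoidHom.ext_int ?_
    change χ (Pi.single i 1) = texp (Pi.single i 1) x
    have h1 := Complex.norm_mul_exp_arg_mul_I (χ (Pi.single i 1))
    rw [hnorm, Complex.ofReal_one, one_mul] at h1
    rw [← h1, texp, Finset.sum_eq_single i]
    · congr 1
      simp only [Pi.single_eq_same, Int.cast_one, one_mul, x]
      push_cast
      have : (Real.pi : ℂ) ≠ 0 := by exact_mod_cast Real.pi_ne_zero
      field_simp
    · intro j _ hj
      simp [hj]
    · simp
  exact congrArg (fun h : (Fin d → ℤ) →+ Additive ℂ => (h k).toMul) hfg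

/-- Wiener's lemma for `H^s`: a nowhere vanishing element is invertible. -/
lemma isUnit_of_forall_ne_zero [CompleteSpace (SobAlg hs)] {a : SobAlg hs}
    (ha : ∀ x, a x ≠ 0) : IsUnit a := by
  by_contra hu
  obtain ⟨φ, hφ⟩ := WeakDual.CharacterSpace.exists_apply_eq_zero hu
  let ψ : SobAlg hs →L[ℂ] ℂ := WeakDual.CharacterSpace.toCLM φ
  have hs0 : 0 ≤ s := le_trans (by positivity) hs.le
  have h0 : φ (expo hs 0) = 1 := by rw [expo_zero, map_one]
  have hmul : ∀ k l, φ (expo hs (k + l)) = φ (expo hs k) * φ (expo hs l) := fun k l => by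
    rw [expo_add, map_mul]
  have hle := norm_le_one_of_polynomial_growth (χ := fun k => φ (expo hs k)) h0 hmul
    (C := ‖ψ‖ * scale d s) hs0 fun k => by
      rw [mul_assoc, ← norm_expo]
      exact ψ.le_opNorm _
  obtain ⟨x, hx⟩ := exists_eq_texp h0 hmul hle
  have h1 : ψ a = evalCLM hs x a := by
    refine tendsto_nhds_unique ((ψ.continuous.tendsto a).comp (tendsto_trunc a)) ?_
    refine (((evalCLM hs x).continuous.tendsto a).comp (tendsto_trunc a)).congr fun S => ?_
    simp only [Function.comp_apply, trunc, map_sum, map_smul]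
    refine Finset.sum_congr rfl fun k _ => ?_
    rw [evalCLM_apply, expo_apply, ← hx]
    rfl
  exact ha x (h1.symm.trans hφ)

/-- A locally bounded map with holomorphic Fourier coefficients is continuous. -/
lemma continuousOn_of_coeff {Q : Set ℂ} (hQ : IsOpen Q) {G : ℂ → SobAlg hs}
    (hG : ∀ k, DifferentiableOn ℂ (fun z => coeff hs k (G z)) Q)
    (hb : ∀ z₀ ∈ Q, ∃ C : ℝ, ∀ᶠ z in 𝓝 z₀, ‖G z‖ ≤ C) : ContinuousOn G Q := by
  intro z₀ hz₀
  obtain ⟨C, hC⟩ := hb z₀ hz₀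
  obtain ⟨r, hr, hball⟩ := Metric.eventually_nhds_iff_ball.1 (hC.and (hQ.mem_nhds hz₀))
  refine (continuousAt_of_locally_lipschitz hr (2 * C / r) fun z hz => ?_).continuousWithinAt
  have hlim := ((tendsto_trunc (G z)).dist (tendsto_trunc (G z₀)))
  refine le_of_tendsto hlim (Eventually.of_forall fun S => ?_)
  have hd : DifferentiableOn ℂ (fun z => trunc S (G z)) (Metric.ball z₀ r) := by
    unfold trunc
    refine DifferentiableOn.fun_sum fun k _ => ?_
    exact ((hG k).mono fun w hw => (hball w hw).2).smul_const _
  refine Complex.dist_le_div_mul_dist_of_mapsTo_ball hd (fun w hw => ?_) hz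
  rw [Metric.mem_closedBall, dist_eq_norm, ← trunc_sub]
  refine (norm_trunc_le _ _).trans ((norm_sub_le _ _).trans ?_)
  linarith [(hball w hw).1, (hball z₀ (Metric.mem_ball_self hr)).1]

end SobAlg

/-- Fourier coefficients of a holomorphic family of functions depend holomorphically on the
parameter. -/
lemma differentiableOn_tcoeff {d : ℕ} {Q : Set ℂ} (hQ : IsOpen Q) {f : (Fin d → ℝ) → ℂ → ℂ}
    (hfc : ContinuousOn (fun p : (Fin d → ℝ) × ℂ => f p.1 p.2) (Set.univ ×ˢ Q))
    (hfan : ∀ x, DifferentiableOn ℂ (f x) Q) (k : Fin d → ℤ) :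
    DifferentiableOn ℂ (fun z => tcoeff (fun x => f x z) k) Q := by
  intro z₀ hz₀
  obtain ⟨r', hr', hsub'⟩ := Metric.isOpen_iff.1 hQ z₀ hz₀
  obtain ⟨r, hr, hsub⟩ : ∃ r > 0, Metric.closedBall z₀ (2 * r) ⊆ Q :=
    ⟨r' / 3, by positivity, (Metric.closedBall_subset_ball (by linarith)).trans hsub'⟩
  have hK : IsCompact ((Set.univ.pi fun _ : Fin d => Set.Icc (0 : ℝ) 1) ×ˢ
      Metric.closedBall z₀ (2 * r)) := isCompact_Icc_cube.prod (isCompact_closedBall _ _)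
  obtain ⟨B, hB⟩ := hK.exists_bound_of_continuousOn
    (hfc.mono (Set.prod_mono (Set.subset_univ _) hsub))
  have hcont : ∀ z ∈ Q, Continuous fun x => f x z := fun z hz => by
    rw [← continuousOn_univ]
    exact hfc.comp (f := fun x => (x, z)) (by fun_prop) fun x _ => ⟨Set.mem_univ _, hz⟩
  have hmemQ : Metric.ball z₀ r ⊆ Q :=
    (Metric.ball_subset_closedBall.trans (Metric.closedBall_subset_closedBall (by linarith))).trans
      hsub
  have hderiv : ∀ x, ∀ z ∈ Q, HasDerivAt (f x) (deriv (f x) z) z := fun x z hz =>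
    ((hfan x).differentiableAt (hQ.mem_nhds hz)).hasDerivAt
  have hmeas : AEStronglyMeasurable (fun x => deriv (f x) z₀) (volume.restrict (unitCube d)) := by
    let t : ℕ → ℂ := fun n => ((r / (n + 2) : ℝ) : ℂ)
    have ht0 : Tendsto t atTop (𝓝[≠] 0) := by
      rw [tendsto_nhdsWithin_iff]
      constructor
      · have h1 : Tendsto (fun n : ℕ => r / ((n : ℝ) + 2)) atTop (𝓝 0) :=
          tendsto_const_nhds.div_atTop (tendsto_natCast_atTop_atTop.atTop_add tendsto_const_nhds)
        have h2 := (Complex.continuous_ofReal.tendsto 0).comp h1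
        simpa using! h2
      · refine Eventually.of_forall fun n => ?_
        have : (0 : ℝ) < r / (n + 2) := by positivity
        exact Complex.ofReal_ne_zero.2 this.ne'
    have htQ : ∀ n, z₀ + t n ∈ Q := fun n => hmemQ (by
      have h1 : (0 : ℝ) < r / (n + 2) := by positivity
      have h2 : r / ((n : ℝ) + 2) < r := div_lt_self hr (by linarith [Nat.cast_nonneg (α := ℝ) n])
      simpa only [Metric.mem_ball, dist_self_add_left, t, Complex.norm_real,
        Real.norm_of_nonneg h1.le] using h2)
    refine aestronglyMeasurable_of_tendsto_ae atTop
      (f := fun n x => (t n)⁻¹ • (f x (z₀ + t n) - f x z₀)) (fun n => ?_)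
      (Eventually.of_forall fun x => ?_)
    · have h : Continuous fun x => (t n)⁻¹ • (f x (z₀ + t n) - f x z₀) := by
        have h1 := hcont _ (htQ n)
        have h2 := hcont _ hz₀
        fun_prop
      exact h.aestronglyMeasurable
    · exact (hasDerivAt_iff_tendsto_slope_zero.1 (hderiv x z₀ hz₀)).comp ht0
  have hmain := hasDerivAt_integral_of_dominated_loc_of_deriv_le
    (μ := volume.restrict (unitCube d)) (F := fun z x => f x z * texp (-k) x)
    (F' := fun z x => deriv (f x) z * texp (-k) x) (x₀ := z₀) (bound := fun _ => B / r)
    (Metric.ball_mem_nhds z₀ hr) ?_ ?_ ?_ ?_ (integrable_const _) ?_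
  · refine DifferentiableAt.differentiableWithinAt ?_
    simp only [tcoeff_eq]
    exact hmain.2.differentiableAt
  · filter_upwards [hQ.mem_nhds hz₀] with z hz
    exact ((hcont z hz).mul (continuous_texp _)).aestronglyMeasurable
  · exact Continuous.integrableOn_unitCube ((hcont z₀ hz₀).mul (continuous_texp _))
  · exact hmeas.mul (continuous_texp _).aestronglyMeasurable
  · refine (ae_restrict_iff' measurableSet_unitCube).2 (Eventually.of_forall fun x hx z hz => ?_)
    rw [norm_mul, norm_texp, mul_one]
    have hzr : Metric.closedBall z r ⊆ Metric.closedBall z₀ (2 * r) :=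
      Metric.closedBall_subset_closedBall' (by linarith [Metric.mem_ball.1 hz])
    refine Complex.norm_deriv_le_of_forall_mem_sphere_norm_le hr ?_ fun w hw => ?_
    · refine DifferentiableOn.diffContOnCl ?_
      rw [closure_ball z hr.ne']
      exact (hfan x).mono (hzr.trans hsub)
    · exact hB (x, w) ⟨unitCube_subset hx, hzr (Metric.sphere_subset_closedBall hw)⟩
  · exact Eventually.of_forall fun x z hz => (hderiv x z (hmemQ hz)).mul_const _

section Contour

variable {V : Type*} [NormedAddCommGroup V] {z w : ℂ}

/-- The boundary of the rectangle with opposite corners `z` and `w`. -/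
def rectBoundary (z w : ℂ) : Set ℂ :=
  {ζ | ζ.re ∈ uIcc z.re w.re ∧ (ζ.im = z.im ∨ ζ.im = w.im) ∨
    (ζ.re = z.re ∨ ζ.re = w.re) ∧ ζ.im ∈ uIcc z.im w.im}

lemma rectBoundary_subset : rectBoundary z w ⊆ uIcc z.re w.re ×ℂ uIcc z.im w.im := by
  rintro ζ (⟨h1, h2 | h2⟩ | ⟨h1 | h1, h2⟩)
  · exact ⟨h1, by simp [h2]⟩
  · exact ⟨h1, by simp [h2]⟩
  · exact ⟨by simp [h1], h2⟩
  · exact ⟨by simp [h1], h2⟩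

lemma bottom_mem_rectBoundary {x : ℝ} (hx : x ∈ uIcc z.re w.re) :
    (x + z.im * Complex.I : ℂ) ∈ rectBoundary z w := by
  left; simpa using hx

lemma top_mem_rectBoundary {x : ℝ} (hx : x ∈ uIcc z.re w.re) :
    (x + w.im * Complex.I : ℂ) ∈ rectBoundary z w := by
  left; simpa using hx

lemma right_mem_rectBoundary {y : ℝ} (hy : y ∈ uIcc z.im w.im) :
    (w.re + y * Complex.I : ℂ) ∈ rectBoundary z w := by
  right; simpa using hy

lemma left_mem_rectBoundary {y : ℝ} (hy : y ∈ uIcc z.im w.im) :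
    (z.re + y * Complex.I : ℂ) ∈ rectBoundary z w := by
  right; simpa using hy

lemma intervalIntegrable_of_continuousOn_rectBoundary {f : ℂ → V}
    (hf : ContinuousOn f (rectBoundary z w)) :
    IntervalIntegrable (fun x : ℝ => f (x + z.im * Complex.I)) volume z.re w.re ∧
    IntervalIntegrable (fun x : ℝ => f (x + w.im * Complex.I)) volume z.re w.re ∧
    IntervalIntegrable (fun y : ℝ => f (w.re + y * Complex.I)) volume z.im w.im ∧
    IntervalIntegrable (fun y : ℝ => f (z.re + y * Complex.I)) volume z.im w.im := by
  refine ⟨?_, ?_, ?_, ?_⟩ <;> refine ContinuousOn.intervalIntegrable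
    (hf.comp (Continuous.continuousOn (by fun_prop)) fun t ht => ?_)
  exacts [bottom_mem_rectBoundary ht, top_mem_rectBoundary ht, right_mem_rectBoundary ht,
    left_mem_rectBoundary ht]

variable [NormedSpace ℂ V]

/-- The integral of `f` along the boundary of the rectangle with opposite corners `z` and `w`. -/
noncomputable def rectIntegral (f : ℂ → V) (z w : ℂ) : V :=
  (∫ x : ℝ in z.re..w.re, f (x + z.im * Complex.I)) -
    (∫ x : ℝ in z.re..w.re, f (x + w.im * Complex.I)) +
    Complex.I • (∫ y : ℝ in z.im..w.im, f (w.re + y * Complex.I)) -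
    Complex.I • ∫ y : ℝ in z.im..w.im, f (z.re + y * Complex.I)

lemma rectIntegral_add {f g : ℂ → V} (hf : ContinuousOn f (rectBoundary z w))
    (hg : ContinuousOn g (rectBoundary z w)) :
    rectIntegral (fun ζ => f ζ + g ζ) z w = rectIntegral f z w + rectIntegral g z w := by
  obtain ⟨f1, f2, f3, f4⟩ := intervalIntegrable_of_continuousOn_rectBoundary hf
  obtain ⟨g1, g2, g3, g4⟩ := intervalIntegrable_of_continuousOn_rectBoundary hg
  simp only [rectIntegral, intervalIntegral.integral_add f1 g1, intervalIntegral.integral_add f2 g2,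
    intervalIntegral.integral_add f3 g3, intervalIntegral.integral_add f4 g4]
  module

lemma rectIntegral_congr {f g : ℂ → V} (h : ∀ ζ ∈ rectBoundary z w, f ζ = g ζ) :
    rectIntegral f z w = rectIntegral g z w := by
  unfold rectIntegral
  congr 1; congr 1; congr 1
  · exact intervalIntegral.integral_congr fun x hx => h _ (bottom_mem_rectBoundary hx)
  · exact intervalIntegral.integral_congr fun x hx => h _ (top_mem_rectBoundary hx)
  · congr 1
    exact intervalIntegral.integral_congr fun x hx => h _ (right_mem_rectBoundary hx)
  · congr 1
    exact intervalIntegral.integral_congr fun x hx => h _ (left_mem_rectBoundary hx)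

lemma ContinuousLinearMap.rectIntegral_comp_comm [CompleteSpace V] {f : ℂ → V} (L : V →L[ℂ] ℂ)
    (hf : ContinuousOn f (rectBoundary z w)) :
    rectIntegral (fun ζ => L (f ζ)) z w = L (rectIntegral f z w) := by
  obtain ⟨f1, f2, f3, f4⟩ := intervalIntegrable_of_continuousOn_rectBoundary hf
  simp only [rectIntegral, map_sub, map_add, map_smul, L.intervalIntegral_comp_comm f1,
    L.intervalIntegral_comp_comm f2, L.intervalIntegral_comp_comm f3,
    L.intervalIntegral_comp_comm f4]

lemma sub_ne_zero_of_mem_rectBoundary {p ζ : ℂ} (hzp : z.re < p.re) (hpw : p.re < w.re)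
    (hzp' : z.im < p.im) (hpw' : p.im < w.im) (hζ : ζ ∈ rectBoundary z w) : ζ - p ≠ 0 := by
  rintro h
  obtain rfl := sub_eq_zero.1 h
  rcases hζ with ⟨-, h2 | h2⟩ | ⟨h1 | h1, -⟩ <;> linarith

/-- The winding number of a rectangle around an interior point is one. -/
lemma rectIntegral_inv_sub {p : ℂ} (hzp : z.re < p.re) (hpw : p.re < w.re)
    (hzp' : z.im < p.im) (hpw' : p.im < w.im) :
    rectIntegral (fun ζ => (ζ - p)⁻¹) z w = 2 * Real.pi * Complex.I := by
  have hne : ∀ ζ ∈ rectBoundary z w, ζ - p ≠ 0 := fun ζ =>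
    sub_ne_zero_of_mem_rectBoundary hzp hpw hzp' hpw'
  have hcont : ContinuousOn (fun ζ => (ζ - p)⁻¹) (rectBoundary z w) :=
    (continuousOn_id.sub continuousOn_const).inv₀ hne
  obtain ⟨i1, i2, i3, i4⟩ := intervalIntegrable_of_continuousOn_rectBoundary hcont
  have hbot := intervalIntegral.integral_eq_sub_of_hasDerivAt (a := z.re) (b := w.re)
    (f := fun x : ℝ => Complex.log (x + z.im * Complex.I - p))
    (f' := fun x : ℝ => (x + z.im * Complex.I - p : ℂ)⁻¹) (fun x _ => by
      have := ((Complex.ofRealCLM.hasDerivAt (x := x)).add_const (z.im * Complex.I)).sub_const p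
      simpa using this.clog_real (by right; simp; linarith)) i1
  have htop := intervalIntegral.integral_eq_sub_of_hasDerivAt (a := z.re) (b := w.re)
    (f := fun x : ℝ => Complex.log (x + w.im * Complex.I - p))
    (f' := fun x : ℝ => (x + w.im * Complex.I - p : ℂ)⁻¹) (fun x _ => by
      have := ((Complex.ofRealCLM.hasDerivAt (x := x)).add_const (w.im * Complex.I)).sub_const p
      simpa using this.clog_real (by right; simp; linarith)) i2
  have hright := intervalIntegral.integral_eq_sub_of_hasDerivAt (a := z.im) (b := w.im)
    (f := fun y : ℝ => Complex.log (w.re + y * Complex.I - p))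
    (f' := fun y : ℝ => Complex.I * (w.re + y * Complex.I - p : ℂ)⁻¹) (fun y _ => by
      have := (((Complex.ofRealCLM.hasDerivAt (x := y)).mul_const Complex.I).const_add
        (w.re : ℂ)).sub_const p
      simpa [div_eq_mul_inv] using this.clog_real (by left; simp; linarith)) (i3.const_mul _)
  have hleft := intervalIntegral.integral_eq_sub_of_hasDerivAt (a := z.im) (b := w.im)
    (f := fun y : ℝ => Complex.log (-(z.re + y * Complex.I - p)))
    (f' := fun y : ℝ => Complex.I * (z.re + y * Complex.I - p : ℂ)⁻¹) (fun y _ => by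
      have := ((((Complex.ofRealCLM.hasDerivAt (x := y)).mul_const Complex.I).const_add
        (z.re : ℂ)).sub_const p).neg
      have h2 := this.clog_real (by left; simp; linarith)
      convert! h2 using 1
      simp only [Pi.neg_apply, Complex.ofRealCLM_apply, Complex.ofReal_one, one_mul, div_eq_mul_inv,
        inv_neg, neg_mul_neg]) (i4.const_mul _)
  rw [intervalIntegral.integral_const_mul] at hright hleft
  unfold rectIntegral
  rw [smul_eq_mul, smul_eq_mul, hbot, htop, hright, hleft]
  have hD : Complex.log (-(z.re + w.im * Complex.I - p)) =
      Complex.log (z.re + w.im * Complex.I - p) - Real.pi * Complex.I := by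
    rw [Complex.log, Complex.log, norm_neg, Complex.arg_neg_eq_arg_sub_pi_of_im_pos (by simpa)]
    push_cast; ring
  have hA : Complex.log (-(z.re + z.im * Complex.I - p)) =
      Complex.log (z.re + z.im * Complex.I - p) + Real.pi * Complex.I := by
    rw [Complex.log, Complex.log, norm_neg, Complex.arg_neg_eq_arg_add_pi_of_im_neg (by simpa)]
    push_cast; ring
  rw [hD, hA]
  ring

/-- Cauchy's integral formula for a rectangle. -/
lemma rectIntegral_inv_sub_mul {p : ℂ} (hzp : z.re < p.re) (hpw : p.re < w.re)
    (hzp' : z.im < p.im) (hpw' : p.im < w.im) {f : ℂ → ℂ}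
    (hf : DifferentiableOn ℂ f (uIcc z.re w.re ×ℂ uIcc z.im w.im)) :
    rectIntegral (fun ζ => f ζ * (ζ - p)⁻¹) z w = 2 * Real.pi * Complex.I * f p := by
  have hne : ∀ ζ ∈ rectBoundary z w, ζ - p ≠ 0 := fun ζ =>
    sub_ne_zero_of_mem_rectBoundary hzp hpw hzp' hpw'
  have hnhds : uIcc z.re w.re ×ℂ uIcc z.im w.im ∈ 𝓝 p := by
    rw [uIcc_of_le (hzp.trans hpw).le, uIcc_of_le (hzp'.trans hpw').le]
    exact inter_mem (Complex.continuous_re.continuousAt.preimage_mem_nhds (Icc_mem_nhds hzp hpw))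
      (Complex.continuous_im.continuousAt.preimage_mem_nhds (Icc_mem_nhds hzp' hpw'))
  have hd := (Complex.differentiableOn_dslope hnhds).2 hf
  have h0 : rectIntegral (dslope f p) z w = 0 :=
    Complex.integral_boundary_rect_eq_zero_of_differentiableOn _ z w hd
  have hcinv : ContinuousOn (fun ζ => (ζ - p)⁻¹) (rectBoundary z w) :=
    (continuousOn_id.sub continuousOn_const).inv₀ hne
  have h1 : rectIntegral (fun ζ => f ζ * (ζ - p)⁻¹) z w =
      rectIntegral (fun ζ => dslope f p ζ + (ζ - p)⁻¹ * f p) z w := by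
    refine rectIntegral_congr fun ζ hζ => ?_
    rw [dslope_of_ne _ (sub_ne_zero.1 (hne ζ hζ)), slope_def_field]
    have := hne ζ hζ
    field_simp
    ring
  have h2 : rectIntegral (fun ζ => (ζ - p)⁻¹ * f p) z w =
      rectIntegral (fun ζ => (ζ - p)⁻¹) z w * f p := by
    simp only [rectIntegral, intervalIntegral.integral_mul_const, smul_eq_mul]
    ring
  rw [h1, rectIntegral_add (hd.continuousOn.mono rectBoundary_subset)
    (hcinv.fun_mul continuousOn_const), h0, h2, rectIntegral_inv_sub hzp hpw hzp' hpw', zero_add]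

end Contour

section Resolvent

variable {A : Type*} [NormedCommRing A] [NormedAlgebra ℂ A]

lemma ContinuousMap.inverse_apply {X : Type*} [TopologicalSpace X] {g : C(X, A)} (hg : IsUnit g)
    (x : X) : Ring.inverse g x = Ring.inverse (g x) := by
  obtain ⟨u, rfl⟩ := hg
  rw [Ring.inverse_unit]
  exact (Ring.inverse_unit (Units.map (ContinuousMap.evalAlgHom ℂ A x : C(X, A) →* A) u)).symm

variable [CompleteSpace A]

/-- The integral of continuous functions over a compact interval, as a continuous linear map. -/
noncomputable def intervalIntegralCLM {a b : ℝ} (hab : a ≤ b) : C(Icc a b, A) →L[ℂ] A :=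
  LinearMap.mkContinuous
    { toFun φ := ∫ t in a..b, φ (projIcc a b hab t)
      map_add' φ ψ := by
        rw [← intervalIntegral.integral_add]
        · rfl
        all_goals exact Continuous.intervalIntegrable (by fun_prop) _ _
      map_smul' c φ := by
        rw [RingHom.id_apply, ← intervalIntegral.integral_smul]; rfl } |b - a| fun φ => by
    rw [mul_comm]
    exact intervalIntegral.norm_integral_le_of_norm_le_const fun t _ => φ.norm_coe_le_norm _

lemma analyticAt_intervalIntegral_mul_inverse {a b : ℝ} (hab : a ≤ b) {g : ℝ → A} {γ : ℝ → ℂ}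
    (hg : ContinuousOn g (Icc a b)) (hγ : ContinuousOn γ (Icc a b)) {v₀ : A}
    (hu : ∀ t ∈ Icc a b, IsUnit (algebraMap ℂ A (γ t) - v₀)) :
    AnalyticAt ℂ (fun v => ∫ t in a..b, g t * Ring.inverse (algebraMap ℂ A (γ t) - v)) v₀ := by
  let g' : C(Icc a b, A) := ⟨_, hg.domRestrict⟩
  let c : C(Icc a b, A) := ⟨fun t => algebraMap ℂ A (γ t),
    (continuous_algebraMap ℂ A).comp hγ.domRestrict⟩
  let k : A →L[ℂ] C(Icc a b, A) := LinearMap.mkContinuous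
    { toFun v := ContinuousMap.const _ v
      map_add' _ _ := rfl
      map_smul' _ _ := rfl } 1 fun v => by
      rw [one_mul]
      exact (ContinuousMap.norm_le _ (norm_nonneg _)).2 fun _ => le_rfl
  have hunit : IsUnit (c - k v₀) :=
    (ContinuousMap.isUnit_iff_forall_isUnit _).2 fun t => hu t t.2
  have hk : AnalyticAt ℂ (fun v => c - k v) v₀ := analyticAt_const.sub (k.analyticAt v₀)
  have hinv : AnalyticAt ℂ (fun v => Ring.inverse (c - k v)) v₀ := by
    obtain ⟨u, hu⟩ := hunit
    exact AnalyticAt.comp (hu ▸ analyticAt_inverse u) hk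
  refine (((intervalIntegralCLM hab).analyticAt _).comp
    (analyticAt_const.mul hinv (f := fun _ => g'))).congr ?_
  filter_upwards [hk.continuousAt.preimage_mem_nhds (Units.isOpen.mem_nhds hunit)] with v hv
  refine intervalIntegral.integral_congr fun t ht => ?_
  rw [uIcc_of_le hab] at ht
  change (g' * Ring.inverse (c - k v)) (projIcc a b hab t) = _
  rw [ContinuousMap.mul_apply, ContinuousMap.inverse_apply hv, projIcc_of_mem hab ht]
  rfl

lemma analyticAt_rectIntegral_mul_inverse {z w : ℂ} (hre : z.re ≤ w.re) (him : z.im ≤ w.im)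
    {g : ℂ → A} (hg : ContinuousOn g (rectBoundary z w)) {v₀ : A}
    (hu : ∀ ζ ∈ rectBoundary z w, IsUnit (algebraMap ℂ A ζ - v₀)) :
    AnalyticAt ℂ
      (fun v => rectIntegral (fun ζ => g ζ * Ring.inverse (algebraMap ℂ A ζ - v)) z w) v₀ := by
  have key : ∀ {a b : ℝ}, a ≤ b → ∀ {γ : ℝ → ℂ}, Continuous γ →
      (∀ t ∈ uIcc a b, γ t ∈ rectBoundary z w) → AnalyticAt ℂ
        (fun v => ∫ t in a..b, g (γ t) * Ring.inverse (algebraMap ℂ A (γ t) - v)) v₀ :=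
    fun hab γ hγ hmem => by
      rw [uIcc_of_le hab] at hmem
      exact analyticAt_intervalIntegral_mul_inverse hab (hg.comp hγ.continuousOn hmem)
        hγ.continuousOn fun t ht => hu _ (hmem t ht)
  exact (((key hre (by fun_prop) fun t => bottom_mem_rectBoundary).sub
    (key hre (by fun_prop) fun t => top_mem_rectBoundary)).add
    ((key him (by fun_prop) fun t => right_mem_rectBoundary).const_smul (c := Complex.I))).sub
    ((key him (by fun_prop) fun t => left_mem_rectBoundary).const_smul (c := Complex.I))

end Resolvent

namespace SobAlg

variable {d : ℕ} {s : ℝ} {hs : (d : ℝ) / 2 < s}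

lemma eval_inverse {a : SobAlg hs} (ha : IsUnit a) (x : Fin d → ℝ) :
    Ring.inverse a x = (a x)⁻¹ := by
  obtain ⟨u, rfl⟩ := ha
  rw [Ring.inverse_unit]
  exact map_units_inv (eval hs x : SobAlg hs →* ℂ) u

lemma algebraMap_sub_apply (ζ : ℂ) (v : SobAlg hs) (x : Fin d → ℝ) :
    (algebraMap ℂ (SobAlg hs) ζ - v) x = ζ - v x := rfl

/-- The imaginary part of a continuous `H^s` function is controlled pointwise by its `H^s` norm. -/
lemma abs_im_apply_le (v : SobAlg hs) (x : Fin d → ℝ) :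
    |(v x).im| ≤ √(invWeightSum d s) * sobNorm s fun x => ((v x).im : ℂ) := by
  have him : (fun x => ((v x).im : ℂ)) =
      (2 * Complex.I)⁻¹ • (⇑v + (-1 : ℂ) • fun x => (starRingEnd ℂ) (v x)) := by
    funext x
    simp only [Pi.smul_apply, Pi.add_apply, smul_eq_mul, Complex.im_eq_sub_conj, neg_one_mul]
    rw [div_eq_inv_mul, sub_eq_add_neg]
  have hcont : Continuous fun x => (starRingEnd ℂ) (v x) :=
    Complex.continuous_conj.comp v.continuous
  have hmem : MemHs s fun x => ((v x).im : ℂ) := by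
    rw [him]
    exact (v.memHs.add (v.memHs.conj.smul _) v.continuous (hcont.const_smul _)).smul _
  have := hmem.norm_apply_le hs
    (Complex.continuous_ofReal.comp (Complex.continuous_im.comp v.continuous)) x
  simpa using this

/-- The composition operator `v ↦ f(·, v(·))` is analytic on continuous `H^s` functions with small
imaginary part. -/
theorem exists_analytic_composition [CompleteSpace (SobAlg hs)] {Q : Set ℂ} (hQ : IsOpen Q)
    (hQR : ∀ r : ℝ, (r : ℂ) ∈ Q) {f : (Fin d → ℝ) → ℂ → ℂ}
    (hfc : ContinuousOn (fun p : (Fin d → ℝ) × ℂ => f p.1 p.2) (Set.univ ×ˢ Q))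
    (hfan : ∀ x : Fin d → ℝ, DifferentiableOn ℂ (f x) Q)
    (hfx : ∀ z ∈ Q, MemHs s (fun x => f x z) ∧ Continuous fun x => f x z)
    (hbd : ∀ R > (0 : ℝ), ∃ C : ℝ, ∀ z ∈ Q, ‖z‖ < R → sobNorm s (fun x => f x z) ≤ C)
    {R : ℝ} (hR : 0 < R) :
    ∃ δ > (0 : ℝ), δ < R ∧ ∃ F : SobAlg hs → SobAlg hs, ∀ v : SobAlg hs, sobNorm s v < R →
      sobNorm s (fun x => ((v x).im : ℂ)) < δ →
        (∀ x, F v x = f x (v x)) ∧ AnalyticAt ℂ F v := by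
  classical
  set c := √(invWeightSum d s) with hc
  have hc0 : 0 ≤ c := Real.sqrt_nonneg _
  set M := c * R + 1 with hM
  have hM0 : 0 < M := by positivity
  obtain ⟨ε, hε, hεQ⟩ := ((isCompact_Icc (a := -M) (b := M)).image
    Complex.continuous_ofReal).exists_cthickening_subset_open hQ
    (by rintro _ ⟨r, -, rfl⟩; exact hQR r)
  let z : ℂ := ⟨-M, -ε⟩
  let w : ℂ := ⟨M, ε⟩
  have hrect : uIcc z.re w.re ×ℂ uIcc z.im w.im ⊆ Q := by
    rintro ζ ⟨h1, h2⟩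
    simp only [mem_preimage, z, w] at h1 h2
    rw [uIcc_of_le (by linarith)] at h1 h2
    refine hεQ (Metric.mem_cthickening_of_dist_le _ _ _ _ ⟨ζ.re, h1, rfl⟩ ?_)
    rw [Complex.dist_of_re_eq (by simp)]
    simpa [Real.dist_eq, abs_le] using h2
  have hbdry : rectBoundary z w ⊆ Q := rectBoundary_subset.trans hrect
  let G : ℂ → SobAlg hs := fun ζ =>
    if hζ : ζ ∈ Q then mk hs (fun x => f x ζ) (hfx ζ hζ).1 (hfx ζ hζ).2 else 0
  have hG : ∀ ζ ∈ Q, ⇑(G ζ) = fun x => f x ζ := fun ζ hζ => by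
    simp only [G, dif_pos hζ, coe_mk]
  have hGcont : ContinuousOn G Q := by
    refine continuousOn_of_coeff hQ (fun k => ?_) fun z₀ hz₀ => ?_
    · refine (differentiableOn_tcoeff hQ hfc hfan k).congr fun ζ hζ => ?_
      rw [coeff_apply, hG ζ hζ]
    · obtain ⟨C, hC⟩ := hbd (‖z₀‖ + 1) (by positivity)
      refine ⟨scale d s * C, ?_⟩
      filter_upwards [hQ.mem_nhds hz₀, continuous_norm.continuousAt.eventually_lt_const
        (lt_add_one ‖z₀‖)] with ζ hζ hζ'
      rw [norm_eq, hG ζ hζ]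
      exact mul_le_mul_of_nonneg_left (hC ζ hζ hζ') (scale_pos d s).le
  refine ⟨min (R / 2) (ε / (2 * (c + 1))), by positivity,
    (min_le_left _ _).trans_lt (half_lt_self hR),
    fun v => (2 * Real.pi * Complex.I : ℂ)⁻¹ •
      rectIntegral (fun ζ => G ζ * Ring.inverse (algebraMap ℂ (SobAlg hs) ζ - v)) z w,
    fun v hv hv' => ?_⟩
  have hre : ∀ x, |(v x).re| < M := fun x => by
    have h1 := v.memHs.norm_apply_le hs v.continuous x
    have h2 : c * sobNorm s v ≤ c * R := mul_le_mul_of_nonneg_left hv.le hc0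
    linarith [Complex.abs_re_le_norm (v x)]
  have him : ∀ x, |(v x).im| < ε := fun x => by
    have h1 := v.abs_im_apply_le x
    have h2 := mul_le_mul_of_nonneg_left (hv'.le.trans (min_le_right _ _)) hc0
    have h3 : c * (ε / (2 * (c + 1))) < ε := by
      rw [mul_div_assoc', div_lt_iff₀ (by positivity)]
      nlinarith
    linarith
  have hunit : ∀ ζ ∈ rectBoundary z w, IsUnit (algebraMap ℂ (SobAlg hs) ζ - v) := fun ζ hζ =>
    isUnit_of_forall_ne_zero fun x => by
      rw [algebraMap_sub_apply]
      exact sub_ne_zero_of_mem_rectBoundary (abs_lt.1 (hre x)).1 (abs_lt.1 (hre x)).2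
        (abs_lt.1 (him x)).1 (abs_lt.1 (him x)).2 hζ
  constructor
  · intro x
    have hcont : ContinuousOn
        (fun ζ => G ζ * Ring.inverse (algebraMap ℂ (SobAlg hs) ζ - v)) (rectBoundary z w) := by
      refine (hGcont.mono hbdry).mul fun ζ hζ => ContinuousAt.continuousWithinAt ?_
      obtain ⟨u, hu⟩ := hunit ζ hζ
      exact ContinuousAt.comp (f := fun ζ => algebraMap ℂ (SobAlg hs) ζ - v)
        (hu ▸ NormedRing.inverse_continuousAt u)
        ((continuous_algebraMap ℂ (SobAlg hs)).sub continuous_const).continuousAt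
    rw [← evalCLM_apply, map_smul, ← ContinuousLinearMap.rectIntegral_comp_comm _ hcont,
      rectIntegral_congr (g := fun ζ => f x ζ * (ζ - v x)⁻¹), rectIntegral_inv_sub_mul
        (abs_lt.1 (hre x)).1 (abs_lt.1 (hre x)).2 (abs_lt.1 (him x)).1 (abs_lt.1 (him x)).2
        ((hfan x).mono hrect), smul_eq_mul, inv_mul_cancel_left₀ Complex.two_pi_I_ne_zero]
    intro ζ hζ
    rw [evalCLM_apply, coe_mul, Pi.mul_apply, hG ζ (hbdry hζ), eval_inverse (hunit ζ hζ),
      algebraMap_sub_apply]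
  · have hzw : z.re ≤ w.re ∧ z.im ≤ w.im := ⟨by simp only [z, w]; linarith,
      by simp only [z, w]; linarith⟩
    exact (analyticAt_rectIntegral_mul_inverse hzw.1 hzw.2 (hGcont.mono hbdry) hunit).const_smul
      (c := (2 * Real.pi * Complex.I : ℂ)⁻¹)

end SobAlg

/-- Example 4.3 of the paper: analyticity of the Nemytskii operator.
`E` is a complex Banach space realizing `H^s(𝕋^d;ℂ)` (via the injective linear map
`toFun` onto the continuous functions of `H^s`, with `‖v‖ = ‖toFun v‖_s`).
If `f(x,u)` is continuous on `𝕋^d × Q` (`Q` an open neighbourhood of `ℝ` in `ℂ`),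
analytic in `u`, `H^s`-smooth in `x`, and `‖f(·,u)‖_s ≤ C(R)` for `u ∈ Q`, `|u| < R`,
then for every `R > 0` and all sufficiently small `δ < R` the composition operator
`F : u(x) ↦ f(x, u(x))` is complex-analytic on
`O(R,δ) = {u : ‖u‖_s < R, ‖Im u‖_s < δ}`. -/
theorem stmt6 {d : ℕ} (hd : 1 ≤ d) (s : ℝ) (hs : s > d / 2)
    {E : Type*} [NormedAddCommGroup E] [NormedSpace ℂ E] [CompleteSpace E]
    (toFun : E →ₗ[ℂ] ((Fin d → ℝ) → ℂ))
    (hinj : Function.Injective toFun)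
    (hnorm : ∀ v : E, ‖v‖ = sobNorm s (toFun v))
    (hmem : ∀ v : E, MemHs s (toFun v) ∧ Continuous (toFun v))
    (hrange : ∀ u : (Fin d → ℝ) → ℂ, MemHs s u → Continuous u → ∃ v : E, toFun v = u)
    (Q : Set ℂ) (hQ : IsOpen Q) (hQR : ∀ r : ℝ, (r : ℂ) ∈ Q)
    (f : (Fin d → ℝ) → ℂ → ℂ)
    (hfc : ContinuousOn (fun p : (Fin d → ℝ) × ℂ => f p.1 p.2) (Set.univ ×ˢ Q))
    (hfper : ∀ z ∈ Q, ZPeriodic fun x => f x z)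
    (hfan : ∀ x : Fin d → ℝ, AnalyticOnNhd ℂ (f x) Q)
    (hfx : ∀ z ∈ Q, MemHs s (fun x => f x z) ∧ Continuous fun x => f x z)
    (hbd : ∀ R > (0 : ℝ), ∃ C : ℝ, ∀ z ∈ Q, ‖z‖ < R → sobNorm s (fun x => f x z) ≤ C)
    (R : ℝ) (hR : 0 < R) :
    ∃ δ > (0 : ℝ), δ < R ∧ ∃ F : E → E,
      (∀ v : E, sobNorm s (toFun v) < R →
        sobNorm s (fun x => ((toFun v x).im : ℂ)) < δ →
        ∀ x, toFun (F v) x = f x (toFun v x)) ∧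
      AnalyticOnNhd ℂ F
        {v : E | sobNorm s (toFun v) < R ∧
          sobNorm s (fun x => ((toFun v x).im : ℂ)) < δ} := by
  let Φ : E →ₗ[ℂ] SobAlg hs :=
    { toFun v := SobAlg.mk hs (toFun v) (hmem v).1 (hmem v).2
      map_add' u v := by ext x; exact congrFun (map_add toFun u v) x
      map_smul' c v := by ext x; exact congrFun (map_smul toFun c v) x }
  have hΦ : Function.Bijective Φ := by
    refine ⟨fun u v h => hinj (congrArg (fun a : SobAlg hs => (a : (Fin d → ℝ) → ℂ)) h),
      fun a => ?_⟩
    obtain ⟨v, hv⟩ := hrange a a.memHs a.continuous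
    exact ⟨v, DFunLike.coe_injective hv⟩
  have hnormΦ : ∀ v, ‖Φ v‖ = SobAlg.scale d s * ‖v‖ := fun v => by
    rw [hnorm v]; exact SobAlg.norm_eq _
  let T : E ≃L[ℂ] SobAlg hs := (LinearEquiv.ofBijective Φ hΦ).toContinuousLinearEquivOfBounds
    (SobAlg.scale d s) (SobAlg.scale d s)⁻¹ (fun v => (hnormΦ v).le) fun a => by
      obtain ⟨v, rfl⟩ := hΦ.2 a
      rw [hnormΦ, inv_mul_cancel_left₀ (SobAlg.scale_pos d s).ne',
        LinearEquiv.ofBijective_symm_apply_apply]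
  have hT : ∀ v, ⇑(T v) = toFun v := fun v => rfl
  have : CompleteSpace (SobAlg hs) := (completeSpace_congr (e := T.toEquiv) T.isUniformEmbedding).1 inferInstance
  obtain ⟨δ, hδ, hδR, F, hF⟩ := SobAlg.exists_analytic_composition (hs := hs) hQ hQR hfc
    (fun x => (hfan x).differentiableOn) hfx hbd hR
  refine ⟨δ, hδ, hδR, fun v => T.symm (F (T v)), fun v hv hv' x => ?_, fun v hv => ?_⟩
  · rw [← hT, T.apply_symm_apply, (hF (T v) hv hv').1 x, hT]
  · exact ((T.symm : SobAlg hs →L[ℂ] E).analyticAt _).comp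
      (AnalyticAt.comp (hF (T v) hv.1 hv.2).2 ((T : E →L[ℂ] SobAlg hs).analyticAt v))
end
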